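/- arXiv:1304.2619 — 3 statements merged into one kernel-verified Lean document; each statement's English description precedes it below -/
import Mathlib

section
/- Let s > 1, y > 0 and R > 0. There exists a constant C_s(R,y) > 0 such that for all u, v ∈ H^s_+(𝕋) with ‖u‖_{H^s} + ‖v‖_{H^s} ≤ R, one has ‖X_{J^y}(u) − X_{J^y}(v)‖_{H^s} ≤ C_s(R,y) ‖u − v‖_{H^s}. In particular X_{J^y} is Lipschitz on bounded subsets of H^s_+(𝕋). -/
open scoped BigOperators ComplexConjugate

noncomputable section

/-- The Hardy space `L²₊(𝕋)` of the circle, modeled by the Hilbert space `ℓ²(ℕ, ℂ)` of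
sequences of nonnegative Fourier (= Taylor) coefficients. -/
abbrev Hardy : Type := lp (fun _ : ℕ => ℂ) 2

/-- The Fourier coefficients of an element of the Hardy space. -/
def coeffs (f : Hardy) : ℕ → ℂ := fun n => f n

/-- Membership in the Sobolev space `Hˢ₊(𝕋)`, expressed on Fourier coefficients. -/
def InHs (s : ℝ) (u : ℕ → ℂ) : Prop :=
  Summable fun k : ℕ => ((1 : ℝ) + (k : ℝ) ^ 2) ^ s * ‖u k‖ ^ 2

/-- The `Hˢ` norm, expressed on Fourier coefficients. -/
def hsNorm (s : ℝ) (u : ℕ → ℂ) : ℝ :=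
  Real.sqrt (∑' k : ℕ, ((1 : ℝ) + (k : ℝ) ^ 2) ^ s * ‖u k‖ ^ 2)

/-- Membership in the Wiener algebra `W`. -/
def InW (u : ℕ → ℂ) : Prop := Summable fun k : ℕ => ‖u k‖

/-- The Wiener norm `‖u‖_W = Σ |û(k)|`. -/
def wienerNorm (u : ℕ → ℂ) : ℝ := ∑' k : ℕ, ‖u k‖

/-- The `L²` norm, expressed on Fourier coefficients. -/
def l2Norm (u : ℕ → ℂ) : ℝ := Real.sqrt (∑' k : ℕ, ‖u k‖ ^ 2)

/-- The Hankel operator `H_u(h) = Π(u h̄)`, expressed on Fourier coefficients: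
`(H_u h)^(n) = Σ_p û(n+p) conj(ĥ(p))`. -/
def hankel (u h : ℕ → ℂ) : ℕ → ℂ := fun n => ∑' p : ℕ, u (n + p) * conj (h p)

/-- The shifted Hankel operator `K_u = S* H_u`. -/
def shiftedHankel (u h : ℕ → ℂ) : ℕ → ℂ := fun n => hankel u h (n + 1)

/-- Fourier coefficients of the pointwise product `fg` of two holomorphic (Hardy class)
functions: the Cauchy product. -/
def mulCoeff (f g : ℕ → ℂ) : ℕ → ℂ := fun n => ∑ p ∈ Finset.range (n + 1), f p * g (n - p)

/-- Fourier coefficients of `T_{a b̄}(h) = Π(a b̄ h)` for `a, b, h` in the Hardy class. -/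
def toeplitzAB (a b h : ℕ → ℂ) : ℕ → ℂ :=
  fun n => ∑' q : ℕ, conj (b q) * mulCoeff a h (n + q)

/-- Fourier coefficients of `T_{ā}(h) = Π(ā h)` for `a, h` in the Hardy class. -/
def toeplitzConj (a h : ℕ → ℂ) : ℕ → ℂ := fun n => ∑' q : ℕ, conj (a q) * h (n + q)

/-- The Szegő nonlinearity `Π(|u|²u) = T_{u ū}(u)`. -/
def szegoNL (u : ℕ → ℂ) : ℕ → ℂ := toeplitzAB u u u

/-- The operator `B_u = (i/2) H_u² - i T_{|u|²}` of the Lax pair. -/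
def laxB (u h : ℕ → ℂ) : ℕ → ℂ := fun n =>
  Complex.I / 2 * hankel u (hankel u h) n - Complex.I * toeplitzAB u u h n

/-- The operator `C_u = (i/2) K_u² - i T_{|u|²}` of the Lax pair. -/
def laxC (u h : ℕ → ℂ) : ℕ → ℂ := fun n =>
  Complex.I / 2 * shiftedHankel u (shiftedHankel u h) n - Complex.I * toeplitzAB u u h n

/-- `u : ℝ → L²₊` is a (smooth in time, `Hˢ`-valued) solution of the cubic Szegő equation
`i ∂_t u = Π(|u|²u)`. -/
def IsSzegoSolution (s : ℝ) (u : ℝ → Hardy) : Prop :=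
  (∀ t, InHs s (coeffs (u t))) ∧ ContDiff ℝ (⊤ : ℕ∞) u ∧
    ∀ t n, HasDerivAt (fun τ : ℝ => coeffs (u τ) n) (-Complex.I * szegoNL (coeffs (u t)) n) t

/-- The Hankel operator with symbol `u` (composed with complex conjugation, which does not
change its range), as a linear map on finitely supported sequences. -/
def hankelLM (u : ℕ → ℂ) : (ℕ →₀ ℂ) →ₗ[ℂ] (ℕ → ℂ) :=
  Finsupp.lsum ℂ fun p => LinearMap.toSpanSingleton ℂ (ℕ → ℂ) fun n => u (n + p)

/-- The rank of the Hankel operator `H_u`. -/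
def hankelRank (u : ℕ → ℂ) : ℕ := Module.finrank ℂ (LinearMap.range (hankelLM u))

/-- The finite rank manifold `𝒱(d)`: `u` with `rk H_u = [(d+1)/2]` and `rk K_u = [d/2]`
(recall `K_u = H_{S*u}`). -/
def InV (d : ℕ) (u : ℕ → ℂ) : Prop :=
  InHs (1 / 2) u ∧ FiniteDimensional ℂ (LinearMap.range (hankelLM u)) ∧
    hankelRank u = (d + 1) / 2 ∧ hankelRank (fun n => u (n + 1)) = d / 2

/-- `w = w^y = (I + y H_u²)⁻¹(1)`, characterized by `(I + y H_u²) w = 1`. -/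
def IsResolventOne (y : ℝ) (u w : ℕ → ℂ) : Prop :=
  Memℓp w 2 ∧ ∀ n, w n + (y : ℂ) * hankel u (hankel u w) n = if n = 0 then 1 else 0

/-- The Hamiltonian vector field `X_{J^y}(u) = 2iy w^y H_u(w^y)` (a pointwise product of two
Hardy class functions), expressed on Fourier coefficients; `w` stands for `w^y`. -/
def XJ (y : ℝ) (u w : ℕ → ℂ) : ℕ → ℂ :=
  fun n => 2 * Complex.I * (y : ℂ) * mulCoeff w (hankel u w) n

/-- The operator `G_u^y(h) = -y w^y Π(conj(w^y) h) + y² (H_u w^y) Π(conj(H_u w^y) h)`;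
`w` stands for `w^y`. -/
def Gop (y : ℝ) (u w h : ℕ → ℂ) : ℕ → ℂ := fun n =>
  -(y : ℂ) * mulCoeff w (toeplitzConj w h) n
    + (y : ℂ) ^ 2 * mulCoeff (hankel u w) (toeplitzConj (hankel u w) h) n

/-- The operator `F_u^y(h) = G_u^y(h) - y² (h | H_u w^y) H_u w^y`; `w` stands for `w^y`. -/
def Fop (y : ℝ) (u w h : ℕ → ℂ) : ℕ → ℂ := fun n =>
  Gop y u w h n - (y : ℂ) ^ 2 * (∑' p : ℕ, h p * conj (hankel u w p)) * hankel u w n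


/-- `f` is square summable with `L²` norm at most `M`. -/
def L2Bound (f : ℕ → ℂ) (M : ℝ) : Prop := ∃ x : Hardy, (∀ n, x n = f n) ∧ ‖x‖ ≤ M

/-- `f` is summable with Wiener norm at most `K`. -/
def WienerBound (f : ℕ → ℂ) (K : ℝ) : Prop := InW f ∧ wienerNorm f ≤ K

/-- The Sobolev weight `(1 + k²)^{s/2}`. -/
def sobolevWeight (s : ℝ) (k : ℕ) : ℝ := ((1 : ℝ) + (k : ℝ) ^ 2) ^ (s / 2)

/-- `f` lies in `Hˢ` with `Hˢ` norm at most `M`. -/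
def HsBound (s : ℝ) (f : ℕ → ℂ) (M : ℝ) : Prop :=
  L2Bound (fun k => (sobolevWeight s k : ℂ) * f k) M

/-- The sum of the inverse Sobolev weights. -/
def weightConst (s : ℝ) : ℝ := ∑' k : ℕ, (sobolevWeight s k)⁻¹

namespace L2Bound

theorem nonneg {f : ℕ → ℂ} {M : ℝ} (h : L2Bound f M) : 0 ≤ M := by
  obtain ⟨x, -, hx⟩ := h
  exact (norm_nonneg x).trans hx

theorem mono {f : ℕ → ℂ} {M N : ℝ} (h : L2Bound f M) (hMN : M ≤ N) : L2Bound f N := by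
  obtain ⟨x, hf, hx⟩ := h
  exact ⟨x, hf, hx.trans hMN⟩

theorem iff_finset {f : ℕ → ℂ} {M : ℝ} (hM : 0 ≤ M) :
    L2Bound f M ↔ ∀ F : Finset ℕ, ∑ k ∈ F, ‖f k‖ ^ 2 ≤ M ^ 2 := by
  constructor
  · rintro ⟨x, hf, hx⟩ F
    have h := lp.sum_rpow_le_norm_rpow (p := 2) (by norm_num) x F
    simp only [hf, ENNReal.toReal_ofNat, Real.rpow_ofNat] at h
    exact h.trans (by gcongr)
  · intro h
    have hmem : Memℓp f 2 := by
      refine memℓp_gen' (C := M ^ 2) fun F => ?_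
      simpa using h F
    refine ⟨⟨f, hmem⟩, fun _ => rfl, ?_⟩
    refine lp.norm_le_of_forall_sum_le (by norm_num) hM fun F => ?_
    simpa using h F

theorem add {f g : ℕ → ℂ} {M N : ℝ} (hf : L2Bound f M) (hg : L2Bound g N) :
    L2Bound (fun n => f n + g n) (M + N) := by
  obtain ⟨x, hxf, hx⟩ := hf
  obtain ⟨z, hzg, hz⟩ := hg
  exact ⟨x + z, fun n => by simp [hxf, hzg], (norm_add_le x z).trans (add_le_add hx hz)⟩

theorem const_mul {f : ℕ → ℂ} {M : ℝ} (c : ℂ) (hf : L2Bound f M) :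
    L2Bound (fun n => c * f n) (‖c‖ * M) := by
  obtain ⟨x, hxf, hx⟩ := hf
  exact ⟨c • x, fun n => by simp [hxf], (norm_smul_le c x).trans (by gcongr)⟩

theorem of_norm_le {f g : ℕ → ℂ} {M : ℝ} (hf : L2Bound f M) (h : ∀ n, ‖g n‖ ≤ ‖f n‖) :
    L2Bound g M := by
  rw [iff_finset hf.nonneg] at *
  intro F
  exact (Finset.sum_le_sum fun k _ => by gcongr; exact h k).trans (hf F)

theorem comp_injective {f : ℕ → ℂ} {M : ℝ} (hf : L2Bound f M) {e : ℕ → ℕ}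
    (he : Function.Injective e) : L2Bound (fun n => f (e n)) M := by
  rw [iff_finset hf.nonneg] at *
  intro F
  simpa using hf (F.map ⟨e, he⟩)

theorem norm_apply_le {f : ℕ → ℂ} {M : ℝ} (hf : L2Bound f M) (n : ℕ) : ‖f n‖ ≤ M := by
  obtain ⟨x, hxf, hx⟩ := hf
  rw [← hxf]
  exact (lp.norm_apply_le_norm (by norm_num) x n).trans hx

/-- Cauchy-Schwarz. -/
theorem summable_mul_conj {f g : ℕ → ℂ} {M N : ℝ} (hf : L2Bound f M) (hg : L2Bound g N) :
    Summable (fun p => f p * conj (g p)) ∧ ‖∑' p, f p * conj (g p)‖ ≤ M * N := by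
  have hM := hf.nonneg
  obtain ⟨x, hxf, hx⟩ := hf
  obtain ⟨z, hzg, hz⟩ := hg
  have h := lp.hasSum_inner (𝕜 := ℂ) z x
  have e : (fun p => inner ℂ (z p) (x p)) = fun p => f p * conj (g p) := by
    funext p
    simp [hxf, hzg, RCLike.inner_apply]
  rw [e] at h
  refine ⟨h.summable, ?_⟩
  rw [h.tsum_eq]
  refine (norm_inner_le_norm z x).trans ?_
  rw [mul_comm]
  gcongr

/-- Minkowski's inequality for an absolutely summable combination. -/
theorem tsum {c : ℕ → ℂ} {x : ℕ → ℕ → ℂ} {K M : ℝ} (hc : WienerBound c K)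
    (hx : ∀ p, L2Bound (x p) M) : L2Bound (fun n => ∑' p, c p * x p n) (K * M) := by
  have hM : 0 ≤ M := (hx 0).nonneg
  choose X hX hXM using hx
  have hle : ∀ p, ‖c p • X p‖ ≤ ‖c p‖ * M := fun p =>
    (norm_smul_le _ _).trans (by gcongr; exact hXM p)
  have hsum : Summable fun p => ‖c p‖ * M := Summable.mul_right M hc.1
  have hs : Summable fun p => c p • X p := Summable.of_norm_bounded hsum hle
  refine ⟨∑' p, c p • X p, fun n => ?_, ?_⟩
  · have h := hs.hasSum.map (lp.evalCLM ℂ (fun _ : ℕ => ℂ) 2 n)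
      (lp.evalCLM ℂ (fun _ : ℕ => ℂ) 2 n).continuous
    have e : ∀ z : Hardy, lp.evalCLM ℂ (fun _ : ℕ => ℂ) 2 n z = z n := fun _ => rfl
    simpa [Function.comp_def, hX, e] using h.tsum_eq.symm
  · refine (tsum_of_norm_bounded hsum.hasSum hle).trans ?_
    rw [tsum_mul_right]
    exact mul_le_mul_of_nonneg_right hc.2 hM

/-- Young's inequality `ℓ¹ * ℓ² ⊆ ℓ²`. -/
theorem mulCoeff {f g : ℕ → ℂ} {K M : ℝ} (hf : WienerBound f K) (hg : L2Bound g M) :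
    L2Bound (mulCoeff f g) (K * M) := by
  have h : ∀ p, L2Bound (fun n => if p ≤ n then g (n - p) else 0) M := by
    intro p
    rw [iff_finset hg.nonneg] at *
    intro F
    calc ∑ k ∈ F, ‖(if p ≤ k then g (k - p) else 0)‖ ^ 2
        = ∑ k ∈ F with p ≤ k, ‖g (k - p)‖ ^ 2 := by
          rw [Finset.sum_filter]
          refine Finset.sum_congr rfl fun k _ => ?_
          split_ifs <;> simp
      _ = ∑ j ∈ (F.filter (p ≤ ·)).image (· - p), ‖g j‖ ^ 2 := by
          rw [Finset.sum_image]
          intro a ha b hb hab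
          simp only [Finset.mem_coe, Finset.mem_filter] at ha hb hab
          omega
      _ ≤ M ^ 2 := hg _
  refine (tsum hf h).of_norm_le fun n => le_of_eq ?_
  congr 1
  rw [tsum_eq_sum (s := Finset.range (n + 1))]
  · refine Finset.sum_congr rfl fun p hp => ?_
    rw [if_pos (by simpa [Nat.lt_succ_iff] using hp)]
  · intro p hp
    rw [if_neg (by simpa [Nat.lt_succ_iff] using hp), mul_zero]

end L2Bound

theorem mulCoeff_comm (f g : ℕ → ℂ) : mulCoeff f g = mulCoeff g f := by
  funext n
  unfold mulCoeff
  rw [← Finset.sum_range_reflect]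
  refine Finset.sum_congr rfl fun p hp => ?_
  have : p ≤ n := by simpa [Nat.lt_succ_iff] using hp
  rw [show n + 1 - 1 - p = n - p by omega, show n - (n - p) = p by omega, mul_comm]

section Weights

variable {s : ℝ}

theorem one_le_sobolevWeight (hs : 0 ≤ s) (k : ℕ) : 1 ≤ sobolevWeight s k :=
  Real.one_le_rpow (by nlinarith [sq_nonneg (k : ℝ)]) (by linarith)

theorem sobolevWeight_pos (k : ℕ) : 0 < sobolevWeight s k :=
  Real.rpow_pos_of_pos (by positivity) _

theorem sobolevWeight_mono (hs : 0 ≤ s) {k l : ℕ} (h : k ≤ l) :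
    sobolevWeight s k ≤ sobolevWeight s l := by
  unfold sobolevWeight
  gcongr

theorem sobolevWeight_sq (k : ℕ) : sobolevWeight s k ^ 2 = ((1 : ℝ) + (k : ℝ) ^ 2) ^ s := by
  unfold sobolevWeight
  rw [← Real.rpow_natCast, ← Real.rpow_mul (by positivity)]
  norm_num

theorem norm_sobolevWeight_mul_sq (k : ℕ) (z : ℂ) :
    ‖(sobolevWeight s k : ℂ) * z‖ ^ 2 = ((1 : ℝ) + (k : ℝ) ^ 2) ^ s * ‖z‖ ^ 2 := by
  rw [norm_mul, mul_pow, Complex.norm_real, Real.norm_eq_abs, sq_abs, sobolevWeight_sq]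

theorem sobolevWeight_add_le (hs : 0 ≤ s) (p q : ℕ) :
    sobolevWeight s (p + q) ≤ 4 ^ (s / 2) * (sobolevWeight s p + sobolevWeight s q) := by
  wlog h : p ≤ q generalizing p q
  · rw [add_comm p q, add_comm (sobolevWeight s p)]
    exact this q p (by omega)
  have h' : (p : ℝ) ≤ q := by exact_mod_cast h
  calc sobolevWeight s (p + q) ≤ (4 * (1 + (q : ℝ) ^ 2)) ^ (s / 2) := by
        unfold sobolevWeight
        push_cast
        gcongr
        nlinarith [(p.cast_nonneg : (0 : ℝ) ≤ p)]
    _ = 4 ^ (s / 2) * sobolevWeight s q := by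
        rw [Real.mul_rpow (by norm_num) (by positivity)]
        rfl
    _ ≤ _ := by
        have := sobolevWeight_pos (s := s) p
        gcongr
        linarith

theorem summable_inv_sobolevWeight (hs : 1 < s) :
    Summable fun k : ℕ => (sobolevWeight s k)⁻¹ := by
  rw [← summable_nat_add_iff 1]
  have h := (summable_nat_add_iff 1).2 (Real.summable_nat_rpow_inv.2 hs)
  refine h.of_nonneg_of_le (fun k => (inv_pos.2 (sobolevWeight_pos _)).le) fun k => ?_
  have e : ((k + 1 : ℕ) : ℝ) ^ s = (((k + 1 : ℕ) : ℝ) ^ 2) ^ (s / 2) := by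
    rw [← Real.rpow_natCast, ← Real.rpow_mul (by positivity)]
    congr 1
    push_cast
    ring
  rw [e]
  unfold sobolevWeight
  gcongr
  linarith

theorem weightConst_nonneg : 0 ≤ weightConst s :=
  tsum_nonneg fun k => (inv_pos.2 (sobolevWeight_pos k)).le

end Weights

theorem WienerBound.of_inv_sobolevWeight {s : ℝ} (hs : 1 < s) {f : ℕ → ℂ} {M : ℝ}
    (h : ∀ n, ‖f n‖ ≤ (sobolevWeight s n)⁻¹ * M) : WienerBound f (weightConst s * M) := by
  have hA := (summable_inv_sobolevWeight hs).mul_right M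
  have hf : Summable fun n => ‖f n‖ := hA.of_nonneg_of_le (fun _ => norm_nonneg _) h
  refine ⟨hf, ?_⟩
  rw [weightConst, ← tsum_mul_right]
  exact hf.tsum_le_tsum h hA

namespace HsBound

variable {s : ℝ}

theorem nonneg {f : ℕ → ℂ} {M : ℝ} (h : HsBound s f M) : 0 ≤ M := L2Bound.nonneg h

theorem mono {f : ℕ → ℂ} {M N : ℝ} (h : HsBound s f M) (hMN : M ≤ N) : HsBound s f N :=
  L2Bound.mono h hMN

theorem congr {f g : ℕ → ℂ} {M : ℝ} (hf : HsBound s f M) (h : ∀ n, f n = g n) :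
    HsBound s g M :=
  funext h ▸ hf

theorem add {f g : ℕ → ℂ} {M N : ℝ} (hf : HsBound s f M) (hg : HsBound s g N) :
    HsBound s (fun n => f n + g n) (M + N) := by
  simpa only [HsBound, mul_add] using L2Bound.add hf hg

theorem const_mul {f : ℕ → ℂ} {M : ℝ} (c : ℂ) (hf : HsBound s f M) :
    HsBound s (fun n => c * f n) (‖c‖ * M) := by
  simpa only [HsBound, mul_left_comm c] using L2Bound.const_mul c hf

theorem of_inHs {f : ℕ → ℂ} (hf : InHs s f) : HsBound s f (hsNorm s f) := by
  refine (L2Bound.iff_finset (Real.sqrt_nonneg _)).2 fun F => ?_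
  simp only [norm_sobolevWeight_mul_sq]
  rw [Real.sq_sqrt (tsum_nonneg fun k => by positivity)]
  exact hf.sum_le_tsum F fun k _ => by positivity

theorem inHs_and_hsNorm_le {f : ℕ → ℂ} {M : ℝ} (hf : HsBound s f M) :
    InHs s f ∧ hsNorm s f ≤ M := by
  have hM := hf.nonneg
  have h := (L2Bound.iff_finset hM).1 hf
  simp only [norm_sobolevWeight_mul_sq] at h
  have h0 : ∀ k : ℕ, 0 ≤ ((1 : ℝ) + (k : ℝ) ^ 2) ^ s * ‖f k‖ ^ 2 := fun k => by positivity
  exact ⟨summable_of_sum_le h0 h, Real.sqrt_le_iff.2 ⟨hM, Real.tsum_le_of_sum_le h0 h⟩⟩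

theorem l2Bound (hs : 0 ≤ s) {f : ℕ → ℂ} {M : ℝ} (hf : HsBound s f M) : L2Bound f M := by
  refine L2Bound.of_norm_le hf fun n => ?_
  rw [norm_mul, Complex.norm_real, Real.norm_of_nonneg (sobolevWeight_pos n).le]
  exact le_mul_of_one_le_left (norm_nonneg _) (one_le_sobolevWeight hs n)

theorem norm_le {f : ℕ → ℂ} {M : ℝ} (hf : HsBound s f M) (n : ℕ) :
    ‖f n‖ ≤ (sobolevWeight s n)⁻¹ * M := by
  have h := L2Bound.norm_apply_le hf n
  rw [norm_mul, Complex.norm_real, Real.norm_of_nonneg (sobolevWeight_pos n).le] at h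
  rwa [le_inv_mul_iff₀ (sobolevWeight_pos n)]

theorem wienerBound (hs : 1 < s) {f : ℕ → ℂ} {M : ℝ} (hf : HsBound s f M) :
    WienerBound f (weightConst s * M) :=
  WienerBound.of_inv_sobolevWeight hs hf.norm_le

theorem shift (hs : 0 ≤ s) {u : ℕ → ℂ} {M : ℝ} (hu : HsBound s u M) (n : ℕ) :
    L2Bound (fun p => (sobolevWeight s n : ℂ) * u (n + p)) M := by
  refine (L2Bound.comp_injective hu (add_right_injective n)).of_norm_le fun p => ?_
  simp only [norm_mul, Complex.norm_real, Real.norm_of_nonneg (sobolevWeight_pos _).le]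
  gcongr
  exact sobolevWeight_mono hs (Nat.le_add_right n p)

theorem hankel (hs : 0 ≤ s) {u h : ℕ → ℂ} {M K : ℝ} (hu : HsBound s u M)
    (hh : WienerBound h K) : HsBound s (hankel u h) (M * K) := by
  have hc : WienerBound (fun p => conj (h p)) K := by
    simpa only [WienerBound, InW, wienerNorm, RCLike.norm_conj] using hh
  have hx : ∀ p, L2Bound (fun n => (sobolevWeight s n : ℂ) * u (n + p)) M := fun p => by
    refine (L2Bound.comp_injective hu (add_left_injective p)).of_norm_le fun n => ?_
    simp only [norm_mul, Complex.norm_real, Real.norm_of_nonneg (sobolevWeight_pos _).le]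
    gcongr
    exact sobolevWeight_mono hs (Nat.le_add_right n p)
  rw [mul_comm M K]
  refine (L2Bound.tsum hc hx).of_norm_le fun n => le_of_eq ?_
  rw [_root_.hankel, ← tsum_mul_left]
  congr 2
  funext p
  ring

/-- The Hankel operator maps `L²` to the Wiener algebra when its symbol is in `Hˢ`, `s > 1`. -/
theorem wienerBound_hankel (hs : 1 < s) {u h : ℕ → ℂ} {M N : ℝ} (hu : HsBound s u M)
    (hh : L2Bound h N) : WienerBound (_root_.hankel u h) (weightConst s * (M * N)) := by
  refine WienerBound.of_inv_sobolevWeight hs fun n => ?_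
  have h := ((hu.shift (by linarith) n).summable_mul_conj hh).2
  simp only [mul_assoc] at h
  rw [tsum_mul_left, norm_mul, Complex.norm_real,
    Real.norm_of_nonneg (sobolevWeight_pos n).le] at h
  rwa [le_inv_mul_iff₀ (sobolevWeight_pos n)]

/-- `Hˢ` is an algebra for `s > 1`. -/
theorem mulCoeff (hs : 1 < s) {f g : ℕ → ℂ} {M N : ℝ} (hf : HsBound s f M)
    (hg : HsBound s g N) :
    HsBound s (mulCoeff f g) (4 ^ (s / 2) * (2 * weightConst s * M * N)) := by
  let F : ℕ → ℂ := fun n => (‖f n‖ : ℂ)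
  let G : ℕ → ℂ := fun n => (‖g n‖ : ℂ)
  have hWF : WienerBound F (weightConst s * M) := by
    simpa [F, WienerBound, InW, wienerNorm] using hf.wienerBound hs
  have hWG : WienerBound G (weightConst s * N) := by
    simpa [G, WienerBound, InW, wienerNorm] using hg.wienerBound hs
  have hF : L2Bound (fun k => (sobolevWeight s k : ℂ) * F k) M :=
    L2Bound.of_norm_le hf fun n => by simp [F]
  have hG : L2Bound (fun k => (sobolevWeight s k : ℂ) * G k) N :=
    L2Bound.of_norm_le hg fun n => by simp [G]
  have h1 := L2Bound.mulCoeff hWG hF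
  rw [mulCoeff_comm] at h1
  have h := ((h1.add (L2Bound.mulCoeff hWF hG)).const_mul ((4 ^ (s / 2) : ℝ) : ℂ))
  have h4 : (0 : ℝ) ≤ 4 ^ (s / 2) := by positivity
  refine L2Bound.mono (L2Bound.of_norm_le h fun n => ?_) (le_of_eq ?_)
  · have key : ((4 ^ (s / 2) : ℝ) : ℂ) *
        (_root_.mulCoeff (fun k => (sobolevWeight s k : ℂ) * F k) G n +
          _root_.mulCoeff F (fun k => (sobolevWeight s k : ℂ) * G k) n) =
        ((∑ p ∈ Finset.range (n + 1), 4 ^ (s / 2) *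
          (sobolevWeight s p + sobolevWeight s (n - p)) * (‖f p‖ * ‖g (n - p)‖) : ℝ) : ℂ) := by
      simp only [_root_.mulCoeff, F, G]
      rw [← Finset.sum_add_distrib, Finset.mul_sum, Complex.ofReal_sum]
      refine Finset.sum_congr rfl fun p _ => ?_
      push_cast
      ring
    rw [key, Complex.norm_real]
    refine le_trans ?_ (le_abs_self _)
    rw [norm_mul, Complex.norm_real, Real.norm_of_nonneg (sobolevWeight_pos n).le]
    refine (mul_le_mul_of_nonneg_left (norm_sum_le _ _) (sobolevWeight_pos n).le).trans ?_
    rw [Finset.mul_sum]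
    refine Finset.sum_le_sum fun p hp => ?_
    rw [norm_mul]
    have hpn : p + (n - p) = n := by
      have : p ≤ n := by simpa [Nat.lt_succ_iff] using hp
      omega
    have := sobolevWeight_add_le (s := s) (by linarith) p (n - p)
    rw [hpn] at this
    gcongr
  · rw [Complex.norm_real, Real.norm_of_nonneg h4]
    ring

end HsBound

section Hankel

variable {s : ℝ}

theorem hankel_summable {u h : ℕ → ℂ} {M N : ℝ} (hu : L2Bound u M) (hh : L2Bound h N) (n : ℕ) :
    Summable fun p => u (n + p) * conj (h p) :=
  ((hu.comp_injective (add_right_injective n)).summable_mul_conj hh).1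

theorem hankel_sub_right {u g h : ℕ → ℂ} {L M N : ℝ} (hu : L2Bound u L) (hg : L2Bound g M)
    (hh : L2Bound h N) (n : ℕ) :
    hankel u (fun k => g k - h k) n = hankel u g n - hankel u h n := by
  unfold hankel
  rw [← (hankel_summable hu hg n).tsum_sub (hankel_summable hu hh n)]
  simp only [map_sub, mul_sub]

theorem hankel_sub_left {u v h : ℕ → ℂ} {L M N : ℝ} (hu : L2Bound u L) (hv : L2Bound v M)
    (hh : L2Bound h N) (n : ℕ) :
    hankel (fun k => u k - v k) h n = hankel u h n - hankel v h n := by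
  unfold hankel
  rw [← (hankel_summable hu hh n).tsum_sub (hankel_summable hv hh n)]
  simp only [sub_mul]

theorem tsum_hankel_mul_conj_comm {u g h : ℕ → ℂ} {M K L : ℝ} (hu : L2Bound u M)
    (hg : WienerBound g K) (hh : WienerBound h L) :
    ∑' n, hankel u g n * conj (h n) = ∑' n, hankel u h n * conj (g n) := by
  have hsum : Summable fun q : ℕ × ℕ => u (q.1 + q.2) * conj (g q.2) * conj (h q.1) := by
    have h1 : Summable fun q : ℕ × ℕ => M * (‖h q.1‖ * ‖g q.2‖) :=
      (Summable.mul_of_nonneg hh.1 hg.1 (fun _ => norm_nonneg _)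
        (fun _ => norm_nonneg _)).mul_left M
    refine Summable.of_norm_bounded h1 fun q => ?_
    simp only [norm_mul, RCLike.norm_conj]
    rw [mul_assoc, mul_comm ‖g q.2‖]
    gcongr
    exact hu.norm_apply_le _
  have h2 : ∑' p, ∑' n, u (n + p) * conj (g p) * conj (h n)
      = ∑' n, ∑' p, u (n + p) * conj (g p) * conj (h n) :=
    Summable.tsum_comm (f := fun n p => u (n + p) * conj (g p) * conj (h n)) hsum
  simp only [hankel, ← tsum_mul_right]
  rw [← h2]
  refine tsum_congr fun p => tsum_congr fun n => ?_
  rw [add_comm n p]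
  ring

/-- `I + y H_u²` is bounded below by `1` on `L²`. -/
theorem L2Bound.of_resolvent_eq (hs : 1 < s) {y : ℝ} (hy : 0 < y) {u d g : ℕ → ℂ} {M N N' : ℝ}
    (hu : HsBound s u M) (hd : L2Bound d N') (hg : HsBound s g N)
    (h : ∀ n, d n + (y : ℂ) * hankel u (hankel u d) n = g n) : L2Bound d N := by
  have hs0 : 0 ≤ s := by linarith
  have hHd := hu.wienerBound_hankel hs hd
  have hHdHs := (hu.hankel hs0 hHd)
  have hdW : ∃ K, HsBound s d K := by
    refine ⟨_, (hg.add ((hHdHs).const_mul (-(y : ℂ)))).congr fun n => ?_⟩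
    rw [← h n]
    ring
  obtain ⟨K, hdK⟩ := hdW
  have hsymm := tsum_hankel_mul_conj_comm (hu.l2Bound hs0) hHd (hdK.wienerBound hs)
  have hgN := hg.l2Bound hs0
  have hN := hg.nonneg
  have e : ∑' n, g n * conj (d n)
      = ∑' n, d n * conj (d n) + y * ∑' n, hankel u d n * conj (hankel u d n) := by
    rw [← hsymm, ← tsum_mul_left, ← (hd.summable_mul_conj hd).1.tsum_add]
    · refine tsum_congr fun n => ?_
      rw [← h n]
      ring
    · exact (((hHdHs.l2Bound hs0).summable_mul_conj hd).1).mul_left _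
  obtain ⟨x, hxd, -⟩ := hd
  refine ⟨x, hxd, ?_⟩
  have hdx : L2Bound d ‖x‖ := ⟨x, hxd, le_rfl⟩
  have e1 : ∑' n, d n * conj (d n) = ((‖x‖ ^ 2 : ℝ) : ℂ) := by
    have := lp.inner_eq_tsum (𝕜 := ℂ) x x
    rw [inner_self_eq_norm_sq_to_K] at this
    simp only [hxd, RCLike.inner_apply] at this
    simpa using this.symm
  have e2 : ∑' n, hankel u d n * conj (hankel u d n)
      = ((∑' n, ‖hankel u d n‖ ^ 2 : ℝ) : ℂ) := by
    rw [Complex.ofReal_tsum]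
    refine tsum_congr fun n => ?_
    rw [Complex.mul_conj']
    push_cast
    rfl
  have hcs := (hgN.summable_mul_conj hdx).2
  rw [e, e1, e2, ← Complex.ofReal_mul, ← Complex.ofReal_add, Complex.norm_real] at hcs
  have h1 := (le_abs_self _).trans hcs
  have h2 : 0 ≤ y * ∑' n, ‖hankel u d n‖ ^ 2 :=
    mul_nonneg hy.le (tsum_nonneg fun _ => by positivity)
  by_contra! hlt
  nlinarith [hN]

theorem HsBound.of_resolvent_eq (hs : 1 < s) {y : ℝ} (hy : 0 < y) {u d g : ℕ → ℂ}
    {M N N' : ℝ} (hu : HsBound s u M) (hd : L2Bound d N') (hg : HsBound s g N)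
    (h : ∀ n, d n + (y : ℂ) * _root_.hankel u (_root_.hankel u d) n = g n) :
    HsBound s d ((1 + y * M ^ 2 * weightConst s) * N) := by
  have hdN := L2Bound.of_resolvent_eq hs hy hu hd hg h
  have h1 := hu.hankel (by linarith) (hu.wienerBound_hankel hs hdN)
  refine ((hg.add (h1.const_mul (-(y : ℂ)))).congr fun n => ?_).mono (le_of_eq ?_)
  · rw [← h n]
    ring
  · rw [norm_neg, Complex.norm_real, Real.norm_of_nonneg hy.le]
    ring

theorem hsBound_one : HsBound s (fun n => if n = 0 then 1 else 0) 1 := by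
  refine (L2Bound.iff_finset zero_le_one).2 fun F => ?_
  calc ∑ k ∈ F, ‖(sobolevWeight s k : ℂ) * (if k = 0 then 1 else 0)‖ ^ 2
      ≤ ∑ k ∈ F, if k = 0 then 1 else 0 := by
        refine Finset.sum_le_sum fun k _ => ?_
        split_ifs with hk <;> simp [hk, sobolevWeight]
    _ ≤ 1 ^ 2 := by
        rw [Finset.sum_ite_eq']
        split_ifs <;> norm_num

theorem IsResolventOne.l2Bound {y : ℝ} {u w : ℕ → ℂ} (h : IsResolventOne y u w) :
    ∃ N, L2Bound w N := ⟨_, ⟨w, h.1⟩, fun _ => rfl, le_rfl⟩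

theorem IsResolventOne.hsBound (hs : 1 < s) {y : ℝ} (hy : 0 < y) {u w : ℕ → ℂ} {M : ℝ}
    (hu : HsBound s u M) (h : IsResolventOne y u w) :
    HsBound s w (1 + y * M ^ 2 * weightConst s) := by
  obtain ⟨N, hN⟩ := h.l2Bound
  simpa using HsBound.of_resolvent_eq hs hy hu hN hsBound_one h.2

end Hankel

/-- The resolvent difference `w_u - w_v` solves a resolvent equation with a small source. -/
theorem IsResolventOne.hsBound_sub {s : ℝ} (hs : 1 < s) {y : ℝ} (hy : 0 < y)
    {u v wu wv : ℕ → ℂ} {R D K : ℝ} (hu : HsBound s u R) (hv : HsBound s v R)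
    (hD : HsBound s (fun n => u n - v n) D) (hwu : IsResolventOne y u wu)
    (hwv : IsResolventOne y v wv) (hK : K = 1 + y * R ^ 2 * weightConst s) :
    HsBound s (fun n => wu n - wv n) (2 * y * R * weightConst s * K ^ 2 * D) := by
  have hs0 : 0 ≤ s := by linarith
  have hWu := hwu.hsBound hs hy hu
  have hWv := hwv.hsBound hs hy hv
  rw [← hK] at hWu hWv
  have lu := hu.l2Bound hs0
  have lv := hv.l2Bound hs0
  have lWu := hWu.l2Bound hs0
  have lWv := hWv.l2Bound hs0
  have hUu := hu.hankel hs0 (hWu.wienerBound hs)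
  have hUv := hu.hankel hs0 (hWv.wienerBound hs)
  have hVv := hv.hankel hs0 (hWv.wienerBound hs)
  have hsource := ((hu.hankel hs0 (hD.wienerBound_hankel hs lWv)).add
    (hD.hankel hs0 (hv.wienerBound_hankel hs lWv))).const_mul (-(y : ℂ))
  have hd : HsBound s (fun n => wu n - wv n) (K + ‖(-1 : ℂ)‖ * K) :=
    (hWu.add (hWv.const_mul (-1))).congr fun n => by ring
  refine (HsBound.of_resolvent_eq hs hy hu (hd.l2Bound hs0) hsource fun n => ?_).mono
    (le_of_eq ?_)
  · have e1 : hankel u (fun k => wu k - wv k) = fun n => hankel u wu n - hankel u wv n :=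
      funext (hankel_sub_right lu lWu lWv)
    have e2 : hankel (fun k => u k - v k) wv = fun n => hankel u wv n - hankel v wv n :=
      funext (hankel_sub_left lu lv lWv)
    rw [e1, e2, hankel_sub_right lu (hUu.l2Bound hs0) (hUv.l2Bound hs0),
      hankel_sub_right lu (hUv.l2Bound hs0) (hVv.l2Bound hs0),
      hankel_sub_left lu lv (hVv.l2Bound hs0)]
    have h1 := hwu.2 n
    have h2 := hwv.2 n
    linear_combination h1 - h2
  · rw [norm_neg, Complex.norm_real, Real.norm_of_nonneg hy.le, ← hK]
    ring

/-- **Lemma 5.1, last estimate**: the Hamiltonian vector field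
`X_{J^y}(u) = 2iy w^y H_u(w^y)` is Lipschitz on bounded subsets of `Hˢ₊`, `s > 1`. -/
theorem statement12 (s : ℝ) (hs : 1 < s) (y R : ℝ) (hy : 0 < y) (hR : 0 < R) :
    ∃ C : ℝ, 0 < C ∧ ∀ u v wu wv : ℕ → ℂ,
      InHs s u → InHs s v → hsNorm s u + hsNorm s v ≤ R →
      IsResolventOne y u wu → IsResolventOne y v wv →
      InHs s (fun n => XJ y u wu n - XJ y v wv n) ∧
        hsNorm s (fun n => XJ y u wu n - XJ y v wv n)
          ≤ C * hsNorm s (fun n => u n - v n) := by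
  have hs0 : 0 ≤ s := by linarith
  set A := weightConst s with hA
  have hA0 : 0 ≤ A := weightConst_nonneg
  obtain ⟨K, hK⟩ : ∃ K, K = 1 + y * R ^ 2 * A := ⟨_, rfl⟩
  obtain ⟨E, hE⟩ : ∃ E, E = 2 * y * R * A * K ^ 2 := ⟨_, rfl⟩
  obtain ⟨B, hB⟩ : ∃ B, B = 2 * y * (4 ^ (s / 2) *
      (2 * A * E * (R * (A * K)) + 2 * A * K * (R * (A * E) + A * K))) := ⟨_, rfl⟩
  have hK0 : 0 ≤ K := by rw [hK]; positivity
  have hE0 : 0 ≤ E := by rw [hE]; positivity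
  have hB0 : 0 ≤ B := by rw [hB]; positivity
  refine ⟨B + 1, by linarith, fun u v wu wv hu hv huv hwu hwv => ?_⟩
  have hu' := HsBound.of_inHs hu
  have hv' := HsBound.of_inHs hv
  have hD : HsBound s (fun n => u n - v n) (hsNorm s fun n => u n - v n) := by
    refine HsBound.of_inHs (HsBound.inHs_and_hsNorm_le (M := hsNorm s u + ‖(-1 : ℂ)‖ * hsNorm s v)
      ((hu'.add (hv'.const_mul (-1))).congr fun n => ?_)).1
    ring
  have hub := hu'.mono (show hsNorm s u ≤ R by linarith [hv'.nonneg])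
  have hvb := hv'.mono (show hsNorm s v ≤ R by linarith [hu'.nonneg])
  set D := hsNorm s fun n => u n - v n
  have hD0 : 0 ≤ D := hD.nonneg
  have hWu := hwu.hsBound hs hy hub
  have hWv := hwv.hsBound hs hy hvb
  have hd := IsResolventOne.hsBound_sub hs hy hub hvb hD hwu hwv hK
  rw [← hA, ← hE] at hd
  rw [← hA, ← hK] at hWu hWv
  have lWu := hWu.l2Bound hs0
  have lWv := hWv.l2Bound hs0
  have h1 := HsBound.mulCoeff hs hd (hub.hankel hs0 (hWu.wienerBound hs))
  have h2 := HsBound.mulCoeff hs hWv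
    ((hub.hankel hs0 (hd.wienerBound hs)).add (hD.hankel hs0 (hWv.wienerBound hs)))
  have hX := (h1.add h2).const_mul (2 * Complex.I * (y : ℂ))
  refine HsBound.inHs_and_hsNorm_le ((hX.congr fun n => ?_).mono ?_)
  · have e : ∀ k, hankel u (fun n => wu n - wv n) k + hankel (fun n => u n - v n) wv k
        = hankel u wu k - hankel v wv k := fun k => by
      rw [hankel_sub_right (hub.l2Bound hs0) lWu lWv,
        hankel_sub_left (hub.l2Bound hs0) (hvb.l2Bound hs0) lWv]
      ring
    simp only [XJ, mulCoeff, e]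
    rw [← mul_sub, ← Finset.sum_add_distrib, ← Finset.sum_sub_distrib]
    congr 1
    refine Finset.sum_congr rfl fun p _ => ?_
    ring
  · have hn : ‖2 * Complex.I * (y : ℂ)‖ = 2 * y := by
      simp [abs_of_pos hy]
    rw [hn]
    calc _ = B * D := by rw [hB]; ring
      _ ≤ (B + 1) * D := by linarith

end
end

section
/- Let s > 1/2, u, a ∈ H^s_+(𝕋), and h ∈ L²_+(𝕋). Then H_{a H_u(a)}(h) = H_u(a)·H_a(h) + H_u( a Π(ā h) − (h|a) a ), where H_u(a)·H_a(h) denotes the pointwise product of the functions H_u(a) and H_a(h). -/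
open scoped BigOperators ComplexConjugate

noncomputable section

/-- A function in `Hˢ` with `s > 1/2` belongs to the Wiener algebra. -/
lemma InHs.inW {s : ℝ} (hs : 1 / 2 < s) {u : ℕ → ℂ} (hu : InHs s u) : InW u := by
  have hweight : Summable fun k : ℕ => ((1 : ℝ) + (k : ℝ) ^ 2) ^ (-s) := by
    refine Summable.of_norm_bounded_eventually_nat
      (Real.summable_nat_rpow.2 (by linarith : -(2 * s) < -1)) ?_
    filter_upwards [Filter.eventually_ge_atTop 1] with k hk
    have hk0 : (0 : ℝ) < k := by exact_mod_cast hk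
    rw [Real.norm_of_nonneg (by positivity), neg_mul_eq_mul_neg, Real.rpow_mul hk0.le,
      Real.rpow_two]
    exact Real.rpow_le_rpow_of_nonpos (by positivity) (by linarith) (by linarith)
  refine Summable.of_nonneg_of_le (fun _ => norm_nonneg _) (fun k => ?_) (hu.add hweight)
  have hpos : 0 < ((1 : ℝ) + (k : ℝ) ^ 2) ^ s := by positivity
  rw [Real.rpow_neg (by positivity)]
  generalize ((1 : ℝ) + (k : ℝ) ^ 2) ^ s = w at hpos ⊢
  have hsq : w * ‖u k‖ ^ 2 + w⁻¹ - ‖u k‖ = w * (‖u k‖ - w⁻¹ / 2) ^ 2 + 3 / 4 * w⁻¹ := by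
    field_simp
    ring
  have : 0 ≤ w * (‖u k‖ - w⁻¹ / 2) ^ 2 + 3 / 4 * w⁻¹ := by positivity
  linarith

/-- Elements of `ℓ²` are bounded. -/
lemma Memℓp.exists_norm_le {h : ℕ → ℂ} (hh : Memℓp h 2) : ∃ C, ∀ n, ‖h n‖ ≤ C := by
  obtain ⟨C, hC⟩ := memℓp_infty_iff.1 (hh.of_exponent_ge le_top)
  exact ⟨C, fun n => hC ⟨n, rfl⟩⟩

/-- Summation of a summable double family along antidiagonals. -/
lemma hasSum_sum_range_of_summable {F : ℕ × ℕ → ℂ} (hF : Summable F) :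
    HasSum (fun m => ∑ j ∈ Finset.range (m + 1), F (j, m - j)) (∑' r, ∑' j, F (j, r)) := by
  have h₁ : HasSum F (∑' r, ∑' j, F (j, r)) := by
    have hswap : Summable fun z : ℕ × ℕ => F z.swap :=
      (Equiv.prodComm ℕ ℕ).summable_iff.2 hF
    have := hswap.tsum_prod
    simp only [Prod.swap_prod_mk] at this
    rw [← this]
    exact (Equiv.prodComm ℕ ℕ).hasSum_iff.1 hswap.hasSum
  have h₂ := ((Finset.HasAntidiagonal.sigmaAntidiagonalEquivProd (A := ℕ)).hasSum_iff.2 h₁).sigma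
    (fun m => (Finset.hasSum (Finset.HasAntidiagonal.antidiagonal m) F))
  simpa only [Finset.Nat.sum_antidiagonal_eq_sum_range_succ_mk] using h₂

/-- `(k, r) ↦ u (n + r + k) a k` is absolutely summable for `u`, `a` in the Wiener algebra. -/
lemma InW.summable_norm_shift_mul {u a : ℕ → ℂ} (hu : InW u) (ha : InW a) :
    Summable fun z : ℕ × ℕ => ‖u (z.2 + z.1)‖ * ‖a z.1‖ := by
  rw [summable_prod_of_nonneg (fun z => mul_nonneg (norm_nonneg _) (norm_nonneg _))]
  refine ⟨fun k =>
    Summable.mul_right ‖a k‖ ((summable_nat_add_iff (f := fun m => ‖u m‖) k).2 hu), ?_⟩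
  refine Summable.of_nonneg_of_le
    (fun k => tsum_nonneg fun _ => mul_nonneg (norm_nonneg _) (norm_nonneg _)) (fun k => ?_)
    (ha.mul_left (∑' m, ‖u m‖))
  simp only [tsum_mul_right]
  refine mul_le_mul_of_nonneg_right ?_ (norm_nonneg _)
  exact tsum_comp_le_tsum_of_inj hu (fun _ => norm_nonneg _) (add_left_injective k)

/-- A Hankel operator with symbol in the Wiener algebra preserves the Wiener algebra. -/
lemma InW.hankel {u a : ℕ → ℂ} (hu : InW u) (ha : InW a) : InW (hankel u a) := by
  have hs := (Equiv.prodComm ℕ ℕ).summable_iff.2 (hu.summable_norm_shift_mul ha)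
  refine Summable.of_nonneg_of_le (fun _ => norm_nonneg _) (fun n => ?_) hs.prod
  refine tsum_of_norm_bounded (hs.prod_factor n).hasSum fun p => ?_
  simp

lemma summable_mul_conj_of_bounded {a h : ℕ → ℂ} (ha : InW a) {C : ℝ} (hC : ∀ n, ‖h n‖ ≤ C)
    (m : ℕ) : Summable fun p => a (m + p) * conj (h p) := by
  refine Summable.of_norm_bounded ((((summable_nat_add_iff m).2 ha)).mul_right C) fun p => ?_
  rw [norm_mul, RCLike.norm_conj, add_comm m p]
  exact mul_le_mul_of_nonneg_left (hC p) (norm_nonneg _)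

lemma norm_toeplitzConj_le {a h : ℕ → ℂ} (ha : InW a) {C : ℝ} (hC : ∀ n, ‖h n‖ ≤ C) (n : ℕ) :
    ‖toeplitzConj a h n‖ ≤ wienerNorm a * C := by
  refine tsum_of_norm_bounded (ha.hasSum.mul_right C) fun p => ?_
  rw [norm_mul, RCLike.norm_conj]
  exact mul_le_mul_of_nonneg_left (hC _) (norm_nonneg _)

/-- The part of a Cauchy product at index `n + p` whose second index exceeds `n`, separated from
the rest. -/
lemma mulCoeff_add (a b : ℕ → ℂ) (n p : ℕ) :
    mulCoeff a b (n + p) = ∑ i ∈ Finset.range (n + 1), b i * a (n - i + p)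
      + ∑ j ∈ Finset.range (p + 1), a j * (if p - j = 0 then 0 else b (n + (p - j))) := by
  rw [mulCoeff, show n + p + 1 = p + (n + 1) by ring, Finset.sum_range_add, add_comm]
  congr 1
  · rw [← Finset.sum_range_reflect]
    refine Finset.sum_congr rfl fun i hi => ?_
    have := Finset.mem_range.1 hi
    rw [mul_comm]
    congr 2 <;> omega
  · rw [Finset.sum_range_succ]
    simp only [Nat.sub_self, if_true, mul_zero, add_zero]
    refine Finset.sum_congr rfl fun j hj => ?_
    have := Finset.mem_range.1 hj
    rw [if_neg (by omega)]
    congr 2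
    omega

/-- Removing the constant term of the second factor of a Cauchy product. -/
lemma mulCoeff_sub_zero_mul (a c : ℕ → ℂ) (m : ℕ) :
    mulCoeff a c m - c 0 * a m
      = ∑ j ∈ Finset.range (m + 1), a j * (if m - j = 0 then 0 else c (m - j)) := by
  have := mulCoeff_add a c 0 m
  simp only [zero_add, Finset.sum_range_one, Nat.sub_zero] at this
  rw [this, add_sub_cancel_left]

/-- **Lemma 5.3**: `H_{aH_u(a)}(h) = H_u(a)·H_a(h) + H_u(a Π(ā h) - (h|a) a)`. -/
theorem statement13 (s : ℝ) (hs : 1 / 2 < s) (u a : ℕ → ℂ) (hu : InHs s u) (ha : InHs s a)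
    (h : ℕ → ℂ) (hh : Memℓp h 2) (n : ℕ) :
    hankel (mulCoeff a (hankel u a)) h n
      = mulCoeff (hankel u a) (hankel a h) n
        + hankel u
            (fun m => mulCoeff a (toeplitzConj a h) m - (∑' p : ℕ, h p * conj (a p)) * a m)
            n := by
  have hu := hu.inW hs
  have ha := ha.inW hs
  obtain ⟨C, hC⟩ := hh.exists_norm_le
  set b := hankel u a with hb
  have hbW : InW b := hu.hankel ha
  set c := toeplitzConj a h with hc
  have hc0 : ∑' p, h p * conj (a p) = c 0 := by
    simp only [hc, toeplitzConj, zero_add, mul_comm]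
  have hcC := norm_toeplitzConj_le ha hC
  have hC0 : 0 ≤ C := (norm_nonneg _).trans (hC 0)
  have hD0 : 0 ≤ wienerNorm a * C := (norm_nonneg _).trans (hcC 0)
  let b' : ℕ → ℂ := fun r => if r = 0 then 0 else b (n + r)
  let c' : ℕ → ℂ := fun r => if r = 0 then 0 else c r
  have hb' : ∀ r, ‖b' r‖ ≤ ‖b (n + r)‖ := fun r => by
    by_cases hr : r = 0 <;> simp [b', hr]
  have hc' : ∀ r, ‖c' r‖ ≤ wienerNorm a * C := fun r => by
    by_cases hr : r = 0
    · simpa [c', hr] using hD0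
    · simpa [c', hr] using hcC r
  have hF : Summable fun z : ℕ × ℕ => a z.1 * b' z.2 * conj (h (z.2 + z.1)) := by
    have hbn : Summable fun r => ‖b (n + r)‖ := by
      simpa only [add_comm n] using (summable_nat_add_iff n).2 hbW
    refine Summable.of_norm_bounded
      ((ha.mul_of_nonneg hbn (fun _ => norm_nonneg _) fun _ => norm_nonneg _).mul_right C)
      fun z => ?_
    rw [norm_mul, norm_mul, RCLike.norm_conj]
    gcongr
    · exact hb' _
    · exact hC _
  have hG : Summable fun z : ℕ × ℕ => u (n + (z.2 + z.1)) * conj (a z.1 * c' z.2) := by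
    have hun : InW fun k => u (n + k) := by
      simpa only [InW, add_comm n] using (summable_nat_add_iff n).2 hu
    refine Summable.of_norm_bounded
      ((hun.summable_norm_shift_mul ha).mul_right (wienerNorm a * C)) fun z => ?_
    rw [norm_mul, RCLike.norm_conj, norm_mul, ← mul_assoc]
    gcongr
    exact hc' _
  have hFsum := hasSum_sum_range_of_summable hF
  have hGsum := hasSum_sum_range_of_summable hG
  have hFG : ∑' r, ∑' j, a j * b' r * conj (h (r + j))
      = ∑' r, ∑' j, u (n + (r + j)) * conj (a j * c' r) := by
    refine tsum_congr fun r => ?_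
    rcases eq_or_ne r 0 with rfl | hr
    · simp [b', c']
    · have h₁ : ∑' j, a j * b' r * conj (h (r + j)) = b (n + r) * conj (c r) := by
        simp only [b', if_neg hr, hc, toeplitzConj, Complex.conj_tsum, map_mul,
          Complex.conj_conj, ← tsum_mul_left]
        exact tsum_congr fun j => by ring
      have h₂ : ∑' j, u (n + (r + j)) * conj (a j * c' r) = b (n + r) * conj (c r) := by
        simp only [c', if_neg hr, hb, hankel, map_mul, ← tsum_mul_right]
        exact tsum_congr fun j => by rw [← add_assoc]; ring
      rw [h₁, h₂]
  have hmain : HasSum (fun p => ∑ i ∈ Finset.range (n + 1), b i * (a (n - i + p) * conj (h p)))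
      (mulCoeff b (hankel a h) n) :=
    hasSum_sum fun i _ => ((summable_mul_conj_of_bounded ha hC (n - i)).hasSum.mul_left _)
  have hleft : hankel (mulCoeff a b) h n = mulCoeff b (hankel a h) n
      + ∑' r, ∑' j, a j * b' r * conj (h (r + j)) := by
    rw [← (hmain.add hFsum).tsum_eq, hankel]
    refine tsum_congr fun p => ?_
    rw [mulCoeff_add, add_mul, Finset.sum_mul, Finset.sum_mul]
    congr 1
    · exact Finset.sum_congr rfl fun i _ => mul_assoc _ _ _
    · refine Finset.sum_congr rfl fun j hj => ?_
      have := Finset.mem_range.1 hj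
      simp only [b', Nat.sub_add_cancel (Nat.le_of_lt_succ this)]
  have hright : hankel u (fun m => mulCoeff a c m - c 0 * a m) n
      = ∑' r, ∑' j, u (n + (r + j)) * conj (a j * c' r) := by
    rw [← hGsum.tsum_eq, hankel]
    refine tsum_congr fun m => ?_
    rw [mulCoeff_sub_zero_mul, map_sum, Finset.mul_sum]
    refine Finset.sum_congr rfl fun j hj => ?_
    have := Finset.mem_range.1 hj
    simp only [c', Nat.sub_add_cancel (Nat.le_of_lt_succ this)]
  rw [hc0, hleft, hright, hFG]

end
end

section
/- Let s > 1/2, y > 0 and u ∈ H^s_+(𝕋). Define the operators G_u^y(h) := −y w^y Π(conj(w^y) h) + y² (H_u w^y) Π(conj(H_u w^y) h) and F_u^y(h) := G_u^y(h) − y² (h | H_u w^y) H_u w^y on L²_+(𝕋). Then H_{iX_{J^y}(u)} = H_u F_u^y + F_u^y H_u and K_{iX_{J^y}(u)} = K_u G_u^y + G_u^y K_u. -/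
open scoped BigOperators ComplexConjugate

noncomputable section

theorem mulCoeff_eq_mul_zero_add (a t : ℕ → ℂ) (n : ℕ) :
    mulCoeff a t (n + 1) = a (n + 1) * t 0 + mulCoeff a (fun m => t (m + 1)) n := by
  unfold mulCoeff
  rw [Finset.sum_range_succ, Nat.sub_self, add_comm]
  congr 1
  refine Finset.sum_congr rfl fun p hp => ?_
  rw [Nat.sub_add_comm (Nat.lt_succ_iff.mp (Finset.mem_range.mp hp))]

theorem toeplitzConj_shift (a h : ℕ → ℂ) :
    (fun n => toeplitzConj a h (n + 1)) = toeplitzConj a (fun m => h (m + 1)) := by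
  funext n
  simp only [toeplitzConj]
  exact tsum_congr fun q => by rw [Nat.add_right_comm]

section bounds

variable {a b h : ℕ → ℂ} {B : ℝ}

theorem summable_shift_norm (ha : Summable fun k => ‖a k‖) (n : ℕ) :
    Summable fun p => ‖a (n + p)‖ :=
  ha.comp_injective (add_right_injective n)

theorem tsum_shift_norm_le (ha : Summable fun k => ‖a k‖) (n : ℕ) :
    ∑' p, ‖a (n + p)‖ ≤ ∑' k, ‖a k‖ :=
  tsum_comp_le_tsum_of_inj ha (fun _ => norm_nonneg _) (add_right_injective n)

theorem summable_norm_mul_of_bounded (ha : Summable fun k => ‖a k‖) (hb : ∀ n, ‖h n‖ ≤ B) :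
    Summable fun k => ‖a k * h k‖ := by
  refine Summable.of_nonneg_of_le (fun _ => norm_nonneg _) (fun k => ?_) (ha.mul_right B)
  rw [norm_mul]
  exact mul_le_mul_of_nonneg_left (hb k) (norm_nonneg _)

theorem norm_tsum_mul_le (ha : Summable fun k => ‖a k‖) (hb : ∀ n, ‖h n‖ ≤ B) :
    ‖∑' k, a k * h k‖ ≤ (∑' k, ‖a k‖) * B := by
  have hs := summable_norm_mul_of_bounded ha hb
  refine (norm_tsum_le_tsum_norm hs).trans ?_
  rw [← tsum_mul_right]
  refine hs.tsum_le_tsum (fun k => ?_) (ha.mul_right B)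
  rw [norm_mul]
  exact mul_le_mul_of_nonneg_left (hb k) (norm_nonneg _)

theorem norm_conj_le (hb : ∀ n, ‖h n‖ ≤ B) (n : ℕ) : ‖conj (h n)‖ ≤ B := by
  rw [RCLike.norm_conj]; exact hb n

theorem summable_norm_conj (ha : Summable fun k => ‖a k‖) :
    Summable fun k => ‖conj (a k)‖ := by
  simpa only [RCLike.norm_conj] using ha

theorem summable_hankel (ha : Summable fun k => ‖a k‖) (hb : ∀ n, ‖h n‖ ≤ B) (n : ℕ) :
    Summable fun p => a (n + p) * conj (h p) :=
  (summable_norm_mul_of_bounded (summable_shift_norm ha n) (norm_conj_le hb)).of_norm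

theorem norm_hankel_le (ha : Summable fun k => ‖a k‖) (hb : ∀ n, ‖h n‖ ≤ B) (n : ℕ) :
    ‖hankel a h n‖ ≤ (∑' k, ‖a k‖) * B :=
  (norm_tsum_mul_le (summable_shift_norm ha n) (norm_conj_le hb)).trans
    (mul_le_mul_of_nonneg_right (tsum_shift_norm_le ha n) ((norm_nonneg _).trans (hb 0)))

theorem hankel_eq_conj_mul_add (ha : Summable fun k => ‖a k‖) (hb : ∀ n, ‖h n‖ ≤ B) (n : ℕ) :
    hankel a h n = conj (h 0) * a n + hankel a (fun m => h (m + 1)) (n + 1) := by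
  unfold hankel
  rw [(summable_hankel ha hb n).tsum_eq_zero_add, add_zero, mul_comm]
  congr 1
  exact tsum_congr fun p => by rw [add_assoc, add_comm 1 p]

theorem hankel_add_mul {h' : ℕ → ℂ} {B' : ℝ} (ha : Summable fun k => ‖a k‖)
    (hb : ∀ n, ‖h n‖ ≤ B) (hb' : ∀ n, ‖h' n‖ ≤ B') (c : ℂ) (n : ℕ) :
    hankel a (fun m => h m + c * h' m) n = hankel a h n + conj c * hankel a h' n := by
  unfold hankel
  rw [← tsum_mul_left, ← (summable_hankel ha hb n).tsum_add ((summable_hankel ha hb' n).mul_left _)]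
  refine tsum_congr fun p => ?_
  simp only [map_add, map_mul]
  ring

theorem hankel_add_left (ha : Summable fun k => ‖a k‖) (hc : Summable fun k => ‖b k‖)
    (hb : ∀ n, ‖h n‖ ≤ B) (n : ℕ) :
    hankel (fun k => a k + b k) h n = hankel a h n + hankel b h n := by
  unfold hankel
  rw [← (summable_hankel ha hb n).tsum_add (summable_hankel hc hb n)]
  exact tsum_congr fun p => add_mul _ _ _

theorem summable_toeplitzConj (ha : Summable fun k => ‖a k‖) (hb : ∀ n, ‖h n‖ ≤ B) (n : ℕ) :
    Summable fun q => conj (a q) * h (n + q) :=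
  (summable_norm_mul_of_bounded (h := fun q => h (n + q)) (summable_norm_conj ha)
    fun q => hb (n + q)).of_norm

theorem norm_toeplitzConj_le_s14 (ha : Summable fun k => ‖a k‖) (hb : ∀ n, ‖h n‖ ≤ B) (n : ℕ) :
    ‖toeplitzConj a h n‖ ≤ (∑' k, ‖a k‖) * B := by
  have := norm_tsum_mul_le (h := fun q => h (n + q)) (summable_norm_conj ha) fun q => hb (n + q)
  simpa only [RCLike.norm_conj, toeplitzConj] using this

theorem toeplitzConj_add_mul {h' : ℕ → ℂ} {B' : ℝ} (ha : Summable fun k => ‖a k‖)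
    (hb : ∀ n, ‖h n‖ ≤ B) (hb' : ∀ n, ‖h' n‖ ≤ B') (c : ℂ) (n : ℕ) :
    toeplitzConj a (fun m => h m + c * h' m) n
      = toeplitzConj a h n + c * toeplitzConj a h' n := by
  unfold toeplitzConj
  rw [← tsum_mul_left, ← (summable_toeplitzConj ha hb n).tsum_add
    ((summable_toeplitzConj ha hb' n).mul_left _)]
  exact tsum_congr fun p => by ring

theorem norm_mulCoeff_le (ha : Summable fun k => ‖a k‖) (hb : ∀ n, ‖h n‖ ≤ B) (n : ℕ) :
    ‖mulCoeff a h n‖ ≤ (∑' k, ‖a k‖) * B := by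
  have hB : 0 ≤ B := (norm_nonneg _).trans (hb 0)
  refine (norm_sum_le _ _).trans ?_
  calc ∑ p ∈ Finset.range (n + 1), ‖a p * h (n - p)‖
      ≤ ∑ p ∈ Finset.range (n + 1), ‖a p‖ * B := Finset.sum_le_sum fun p _ => by
        rw [norm_mul]
        exact mul_le_mul_of_nonneg_left (hb _) (norm_nonneg _)
    _ = (∑ p ∈ Finset.range (n + 1), ‖a p‖) * B := by rw [Finset.sum_mul]
    _ ≤ _ := mul_le_mul_of_nonneg_right (ha.sum_le_tsum _ fun _ _ => norm_nonneg _) hB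

theorem summable_norm_mulCoeff (ha : Summable fun k => ‖a k‖) (hb : Summable fun k => ‖b k‖) :
    Summable fun n => ‖mulCoeff a b n‖ :=
  summable_norm_sum_mul_range_of_summable_norm ha hb

theorem norm_le_tsum_norm (ha : Summable fun k => ‖a k‖) (n : ℕ) : ‖a n‖ ≤ ∑' k, ‖a k‖ :=
  ha.le_tsum n fun _ _ => norm_nonneg _

/-- The Hankel operator is bounded on the Wiener algebra. -/
theorem sum_norm_hankel_le (ha : Summable fun k => ‖a k‖) (hb : Summable fun k => ‖b k‖) (M : ℕ) :
    ∑ n ∈ Finset.range M, ‖hankel a b n‖ ≤ (∑' k, ‖a k‖) * ∑' k, ‖b k‖ := by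
  have hs (n : ℕ) : Summable fun p => ‖a (n + p)‖ * ‖b p‖ := by
    simpa using summable_norm_mul_of_bounded (summable_shift_norm ha n) (norm_le_tsum_norm hb)
  calc ∑ n ∈ Finset.range M, ‖hankel a b n‖
      ≤ ∑ n ∈ Finset.range M, ∑' p, ‖a (n + p)‖ * ‖b p‖ := Finset.sum_le_sum fun n _ => by
        unfold hankel
        refine (norm_tsum_le_tsum_norm ?_).trans_eq ?_ <;> simp [hs n]
    _ = ∑' p, ∑ n ∈ Finset.range M, ‖a (n + p)‖ * ‖b p‖ :=
        (Summable.tsum_finsetSum fun n _ => hs n).symm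
    _ ≤ ∑' p, (∑' k, ‖a k‖) * ‖b p‖ := by
        refine (summable_sum fun n _ => hs n).tsum_le_tsum (fun p => ?_) (hb.mul_left _)
        rw [← Finset.sum_mul]
        refine mul_le_mul_of_nonneg_right ?_ (norm_nonneg _)
        have h1 : Summable fun n => ‖a (n + p)‖ := ha.comp_injective (add_left_injective p)
        exact (h1.sum_le_tsum _ fun _ _ => norm_nonneg _).trans
          (tsum_comp_le_tsum_of_inj ha (fun _ => norm_nonneg _) (add_left_injective p))
    _ = _ := tsum_mul_left

theorem summable_norm_hankel (ha : Summable fun k => ‖a k‖) (hb : Summable fun k => ‖b k‖) :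
    Summable fun n => ‖hankel a b n‖ :=
  summable_of_sum_range_le (fun _ => norm_nonneg _) (sum_norm_hankel_le ha hb)

theorem summable_norm_mul_norm_shift (ha : Summable fun k => ‖a k‖)
    (hb : Summable fun k => ‖b k‖) :
    Summable fun x : ℕ × ℕ => ‖b x.1‖ * ‖a (x.1 + x.2)‖ := by
  have h0 : ∀ x : ℕ × ℕ, 0 ≤ ‖b x.1‖ * ‖a (x.1 + x.2)‖ := fun x => by positivity
  have h1 : ∀ n, Summable fun m => ‖b n‖ * ‖a (n + m)‖ :=
    fun n => (summable_shift_norm ha n).mul_left ‖b n‖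
  refine (summable_prod_of_nonneg h0).2 ⟨h1, ?_⟩
  simp only [tsum_mul_left]
  refine Summable.of_nonneg_of_le
    (fun n => mul_nonneg (norm_nonneg _) (tsum_nonneg fun _ => norm_nonneg _)) (fun n => ?_)
    (hb.mul_right (∑' k, ‖a k‖))
  exact mul_le_mul_of_nonneg_left (tsum_shift_norm_le ha n) (norm_nonneg _)

/-- The symmetry `(H_a h | b) = (H_a b | h)`. -/
theorem tsum_hankel_mul_conj_comm_s14 (ha : Summable fun k => ‖a k‖) (hb : Summable fun k => ‖b k‖)
    (hh : ∀ n, ‖h n‖ ≤ B) :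
    ∑' n, hankel a h n * conj (b n) = ∑' p, hankel a b p * conj (h p) := by
  have hs : Summable fun x : ℕ × ℕ => a (x.1 + x.2) * conj (h x.2) * conj (b x.1) := by
    refine Summable.of_norm_bounded ((summable_norm_mul_norm_shift ha hb).mul_right B) fun x => ?_
    rw [norm_mul, norm_mul, RCLike.norm_conj, RCLike.norm_conj]
    have h1 := mul_le_mul_of_nonneg_left (hh x.2)
      (mul_nonneg (norm_nonneg (b x.1)) (norm_nonneg (a (x.1 + x.2))))
    linarith
  have hcomm : ∑' n, ∑' p, a (n + p) * conj (h p) * conj (b n)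
      = ∑' p, ∑' n, a (n + p) * conj (h p) * conj (b n) :=
    (Summable.tsum_comm (f := fun n p => a (n + p) * conj (h p) * conj (b n)) hs).symm
  unfold hankel
  simp only [← tsum_mul_right]
  rw [hcomm]
  refine tsum_congr fun p => tsum_congr fun n => ?_
  rw [add_comm n p]
  ring

end bounds

/-- `Hˢ₊(𝕋)` is contained in the Wiener algebra for `s > 1/2`. -/
theorem InHs.summable_norm {s : ℝ} (hs : 1 / 2 < s) {u : ℕ → ℂ} (hu : InHs s u) :
    Summable fun k => ‖u k‖ := by
  have h1 : Summable fun k : ℕ => ((1 : ℝ) + (k : ℝ) ^ 2) ^ (-s) := by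
    rw [← summable_nat_add_iff 1]
    refine Summable.of_nonneg_of_le (fun k => by positivity) (fun k => ?_)
      ((summable_nat_add_iff 1).2 (Real.summable_nat_rpow (p := -(2 * s)).2 (by linarith)))
    rw [show -(2 * s) = 2 * (-s) by ring, Real.rpow_mul (by positivity)]
    refine Real.rpow_le_rpow_of_nonpos (by positivity) ?_ (by linarith)
    norm_num
  refine Summable.of_nonneg_of_le (fun k => norm_nonneg _) (fun k => ?_) (h1.add hu)
  have h2 : 0 < ((1 : ℝ) + (k : ℝ) ^ 2) ^ s := by positivity
  rw [Real.rpow_neg (by positivity)]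
  set t := ((1 : ℝ) + (k : ℝ) ^ 2) ^ s
  have h3 : t⁻¹ + t * ‖u k‖ ^ 2 - ‖u k‖ = t * (‖u k‖ - t⁻¹ / 2) ^ 2 + 3 / 4 * t⁻¹ := by
    field_simp
    ring
  have h4 : 0 ≤ t * (‖u k‖ - t⁻¹ / 2) ^ 2 + 3 / 4 * t⁻¹ := by positivity
  linarith

/-- A bounded solution of `w + y H_v² w = f` with `y ‖v‖_W² < 1` and `f` in the Wiener algebra
lies in the Wiener algebra. -/
theorem summable_norm_of_add_hankel_hankel {y : ℝ} (hy : 0 ≤ y) {v w f : ℕ → ℂ} {B : ℝ}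
    (hv : Summable fun k => ‖v k‖) (hw : ∀ n, ‖w n‖ ≤ B) (hf : Summable fun k => ‖f k‖)
    (hyv : y * (∑' k, ‖v k‖) ^ 2 < 1)
    (heq : ∀ n, w n + (y : ℂ) * hankel v (hankel v w) n = f n) :
    Summable fun k => ‖w k‖ := by
  set V := ∑' k, ‖v k‖ with hV
  set θ := y * V ^ 2 with hθ
  have hV0 : 0 ≤ V := tsum_nonneg fun _ => norm_nonneg _
  have hθ0 : 0 ≤ θ := by positivity
  set C := (∑' k, ‖f k‖) / (1 - θ) with hC
  have hC0 : 0 ≤ C := div_nonneg (tsum_nonneg fun _ => norm_nonneg _) (by linarith)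
  have hCeq : (∑' k, ‖f k‖) + θ * C = C := by
    have : 1 - θ ≠ 0 := by linarith
    rw [hC]; field_simp; ring
  have key : ∀ j : ℕ, ∃ z : ℕ → ℂ, Summable (fun k => ‖z k‖) ∧ ∑' k, ‖z k‖ ≤ C ∧
      ∀ n, ‖w n - z n‖ ≤ θ ^ j * B := by
    intro j
    induction j with
    | zero => exact ⟨0, by simp, by simpa using hC0, by simpa using hw⟩
    | succ j ih =>
      obtain ⟨z, hz, hzC, hwz⟩ := ih
      have h1 := summable_norm_hankel hv hz
      have h2 : ∑' k, ‖hankel v z k‖ ≤ V * C :=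
        (Real.tsum_le_of_sum_range_le (fun _ => norm_nonneg _) (sum_norm_hankel_le hv hz)).trans
          (mul_le_mul_of_nonneg_left hzC hV0)
      have h3 (M : ℕ) : ∑ n ∈ Finset.range M, ‖f n + -(y : ℂ) * hankel v (hankel v z) n‖ ≤ C := by
        calc _ ≤ ∑ n ∈ Finset.range M, (‖f n‖ + y * ‖hankel v (hankel v z) n‖) :=
              Finset.sum_le_sum fun n _ => (norm_add_le _ _).trans_eq (by
                rw [norm_mul, norm_neg, Complex.norm_real, Real.norm_of_nonneg hy])
          _ = ∑ n ∈ Finset.range M, ‖f n‖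
              + y * ∑ n ∈ Finset.range M, ‖hankel v (hankel v z) n‖ := by
              rw [Finset.sum_add_distrib, Finset.mul_sum]
          _ ≤ (∑' k, ‖f k‖) + y * (V * (V * C)) := by
              gcongr
              · exact hf.sum_le_tsum _ fun _ _ => norm_nonneg _
              · exact (sum_norm_hankel_le hv h1 M).trans (mul_le_mul_of_nonneg_left h2 hV0)
          _ = C := by linear_combination hCeq
      refine ⟨fun n => f n + -(y : ℂ) * hankel v (hankel v z) n,
        summable_of_sum_range_le (fun _ => norm_nonneg _) h3,
        Real.tsum_le_of_sum_range_le (fun _ => norm_nonneg _) h3, fun n => ?_⟩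
      have hzb := norm_le_tsum_norm hz
      have h4 : hankel v (fun m => w m + -1 * z m)
          = fun m => hankel v w m + -1 * hankel v z m := by
        funext m
        rw [hankel_add_mul hv hw hzb]
        simp
      have h5 : hankel v (hankel v fun m => w m + -1 * z m) n
          = hankel v (hankel v w) n - hankel v (hankel v z) n := by
        rw [h4, hankel_add_mul hv (norm_hankel_le hv hw) (norm_hankel_le hv hzb)]
        simp [sub_eq_add_neg]
      have h6 : w n - (f n + -(y : ℂ) * hankel v (hankel v z) n)
          = -(y : ℂ) * hankel v (hankel v fun m => w m + -1 * z m) n := by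
        rw [h5, ← heq n]; ring
      rw [h6, norm_mul, norm_neg, Complex.norm_real, Real.norm_of_nonneg hy]
      have h7 : ∀ m, ‖w m + -1 * z m‖ ≤ θ ^ j * B := fun m => by
        simpa [← sub_eq_add_neg] using hwz m
      calc _ ≤ y * (V * (V * (θ ^ j * B))) :=
            mul_le_mul_of_nonneg_left (norm_hankel_le hv (norm_hankel_le hv h7) n) hy
        _ = θ ^ (j + 1) * B := by rw [hθ]; ring
  refine summable_of_sum_range_le (c := C) (fun _ => norm_nonneg _) fun M => ?_
  have hlim : Filter.Tendsto (fun j : ℕ => C + M * (θ ^ j * B)) Filter.atTop (nhds C) := by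
    simpa using (((tendsto_pow_atTop_nhds_zero_of_lt_one hθ0 hyv).mul_const B).const_mul
      (M : ℝ)).const_add C
  refine ge_of_tendsto' hlim fun j => ?_
  obtain ⟨z, hz, hzC, hwz⟩ := key j
  calc ∑ n ∈ Finset.range M, ‖w n‖ ≤ ∑ n ∈ Finset.range M, (‖z n‖ + θ ^ j * B) :=
        Finset.sum_le_sum fun n _ => by
          have := norm_add_le (z n) (w n - z n)
          rw [add_sub_cancel] at this
          linarith [hwz n]
    _ ≤ C + M * (θ ^ j * B) := by
        rw [Finset.sum_add_distrib, Finset.sum_const, Finset.card_range, nsmul_eq_mul]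
        gcongr
        exact (hz.sum_le_tsum _ fun _ _ => norm_nonneg _).trans hzC

theorem hankel_eq_zero_of_le {a : ℕ → ℂ} {N : ℕ} (ha : ∀ k, N ≤ k → a k = 0) (h : ℕ → ℂ) {n : ℕ}
    (hn : N ≤ n) : hankel a h n = 0 := by
  unfold hankel
  simp [ha _ (hn.trans (Nat.le_add_right _ _))]

theorem summable_norm_of_eq_zero {a : ℕ → ℂ} {N : ℕ} (ha : ∀ k, N ≤ k → a k = 0) :
    Summable fun k => ‖a k‖ :=
  summable_of_ne_finset_zero (s := Finset.range N) fun k hk => by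
    rw [ha k (by simpa using hk), norm_zero]

/-- The function `w^y` belongs to the Wiener algebra as soon as `u` does. -/
theorem IsResolventOne.summable_norm {y : ℝ} (hy : 0 ≤ y) {u w : ℕ → ℂ} {B : ℝ}
    (hu : Summable fun k => ‖u k‖) (hwB : ∀ n, ‖w n‖ ≤ B) (hw : IsResolventOne y u w) :
    Summable fun k => ‖w k‖ := by
  obtain ⟨N, hN⟩ : ∃ N : ℕ, y * (∑' k, ‖u (k + N)‖) ^ 2 < 1 := by
    have h1 := tendsto_sum_nat_add fun k => ‖u k‖
    have h2 := ((h1.pow 2).const_mul y)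
    rw [zero_pow two_ne_zero, mul_zero] at h2
    exact (h2.eventually (gt_mem_nhds one_pos)).exists
  let p : ℕ → ℂ := fun k => if k < N then u k else 0
  let v : ℕ → ℂ := fun k => if k < N then 0 else u k
  have hpz : ∀ k, N ≤ k → p k = 0 := fun k hk => if_neg (by omega)
  have hp : Summable fun k => ‖p k‖ := summable_norm_of_eq_zero hpz
  have huv : u = fun k => p k + v k := by
    funext k; by_cases hk : k < N <;> simp [p, v, hk]
  have hvs : Summable fun k => ‖v k‖ :=
    Summable.of_nonneg_of_le (fun _ => norm_nonneg _)
      (fun k => by by_cases hk : k < N <;> simp [v, hk]) hu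
  have hvt : ∑' k, ‖v k‖ = ∑' k, ‖u (k + N)‖ := by
    rw [← hvs.sum_add_tsum_nat_add N, Finset.sum_eq_zero, zero_add]
    · exact tsum_congr fun k => by simp [v]
    · intro k hk
      simp [v, Finset.mem_range.mp hk]
  have hg := norm_hankel_le hu hwB
  have hpw := norm_hankel_le hp hwB
  have hvw := norm_hankel_le hvs hwB
  have hpw1 : Summable fun n => ‖hankel p w n‖ :=
    summable_norm_of_eq_zero fun k hk => hankel_eq_zero_of_le hpz w hk
  have hpg1 : Summable fun n => ‖hankel p (hankel u w) n‖ :=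
    summable_norm_of_eq_zero fun k hk => hankel_eq_zero_of_le hpz _ hk
  have hsplit : hankel u w = fun n => hankel v w n + 1 * hankel p w n := by
    funext n
    conv_lhs => rw [huv]
    rw [hankel_add_left hp hvs hwB]
    ring
  have hsplit2 (n : ℕ) : hankel u (hankel u w) n
      = hankel p (hankel u w) n + (hankel v (hankel v w) n + hankel v (hankel p w) n) := by
    have h1 : hankel u (hankel u w) n
        = hankel p (hankel u w) n + hankel v (hankel u w) n := by
      conv_lhs => rw [show hankel u (hankel u w) = hankel (fun k => p k + v k) (hankel u w) by
        rw [← huv]]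
      exact hankel_add_left hp hvs hg n
    rw [h1]
    congr 1
    conv_lhs => rw [hsplit]
    rw [hankel_add_mul hvs hvw hpw, map_one, one_mul]
  have h1 : Summable fun n : ℕ => ‖(if n = 0 then 1 else 0 : ℂ)‖ :=
    summable_norm_of_eq_zero (N := 1) fun k hk => if_neg (by omega)
  refine summable_norm_of_add_hankel_hankel hy hvs hwB
    (f := fun n => (if n = 0 then 1 else 0)
      - (y : ℂ) * (hankel p (hankel u w) n + hankel v (hankel p w) n)) ?_ (by rwa [hvt]) ?_
  · have h2 : Summable fun n =>
        ‖(y : ℂ)‖ * (‖hankel p (hankel u w) n‖ + ‖hankel v (hankel p w) n‖) :=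
      (hpg1.add (summable_norm_hankel hvs hpw1)).mul_left _
    refine Summable.of_nonneg_of_le (fun _ => norm_nonneg _) (fun n => ?_) (h1.add h2)
    refine (norm_sub_le _ _).trans (add_le_add le_rfl ?_)
    rw [norm_mul]
    exact mul_le_mul_of_nonneg_left (norm_add_le _ _) (norm_nonneg _)
  · intro n
    rw [← hw.2 n, hsplit2 n]
    ring

section operators

variable {y : ℝ} {u w h : ℕ → ℂ} {B : ℝ}

theorem toeplitzConj_comm_hankel (a b : ℕ → ℂ) : toeplitzConj a b = hankel b a := by
  funext n
  exact tsum_congr fun q => mul_comm _ _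

theorem mulCoeff_add_mul (a f f' : ℕ → ℂ) (c : ℂ) (n : ℕ) :
    mulCoeff a (fun m => f m + c * f' m) n = mulCoeff a f n + c * mulCoeff a f' n := by
  unfold mulCoeff
  rw [Finset.mul_sum, ← Finset.sum_add_distrib]
  exact Finset.sum_congr rfl fun p _ => by ring

theorem mulCoeff_comm_s14 (a b : ℕ → ℂ) : mulCoeff a b = mulCoeff b a := by
  funext n
  unfold mulCoeff
  rw [← Finset.sum_range_reflect]
  refine Finset.sum_congr rfl fun p hp => ?_
  have : p ≤ n := Nat.lt_succ_iff.mp (Finset.mem_range.mp hp)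
  rw [mul_comm]
  congr 2
  omega

theorem toeplitzConj_zero_eq (a h : ℕ → ℂ) :
    toeplitzConj a h 0 = ∑' p, h p * conj (a p) := by
  unfold toeplitzConj
  exact tsum_congr fun q => by rw [zero_add, mul_comm]

theorem norm_Gop_le (hy : 0 ≤ y) (hw : Summable fun k => ‖w k‖)
    (hg : Summable fun k => ‖hankel u w k‖) (hb : ∀ n, ‖h n‖ ≤ B) (n : ℕ) :
    ‖Gop y u w h n‖
      ≤ (y * (∑' k, ‖w k‖) ^ 2 + y ^ 2 * (∑' k, ‖hankel u w k‖) ^ 2) * B := by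
  refine (norm_add_le _ _).trans ?_
  rw [norm_mul, norm_mul, norm_neg, norm_pow, Complex.norm_real, Real.norm_of_nonneg hy]
  calc _ ≤ y * ((∑' k, ‖w k‖) * ((∑' k, ‖w k‖) * B))
        + y ^ 2 * ((∑' k, ‖hankel u w k‖) * ((∑' k, ‖hankel u w k‖) * B)) := by
        gcongr
        · exact norm_mulCoeff_le hw (norm_toeplitzConj_le_s14 hw hb) n
        · exact norm_mulCoeff_le hg (norm_toeplitzConj_le_s14 hg hb) n
    _ = _ := by ring

theorem norm_Fop_le (hy : 0 ≤ y) (hw : Summable fun k => ‖w k‖)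
    (hg : Summable fun k => ‖hankel u w k‖) (hb : ∀ n, ‖h n‖ ≤ B) (n : ℕ) :
    ‖Fop y u w h n‖
      ≤ (y * (∑' k, ‖w k‖) ^ 2 + 2 * y ^ 2 * (∑' k, ‖hankel u w k‖) ^ 2) * B := by
  refine (norm_sub_le _ _).trans ?_
  rw [norm_mul, norm_mul, norm_pow, Complex.norm_real, Real.norm_of_nonneg hy,
    ← toeplitzConj_zero_eq]
  have hB : 0 ≤ B := (norm_nonneg _).trans (hb 0)
  calc _ ≤ (y * (∑' k, ‖w k‖) ^ 2 + y ^ 2 * (∑' k, ‖hankel u w k‖) ^ 2) * B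
        + y ^ 2 * ((∑' k, ‖hankel u w k‖) * B) * (∑' k, ‖hankel u w k‖) := by
        gcongr
        · exact norm_Gop_le hy hw hg hb n
        · exact norm_toeplitzConj_le_s14 hg hb 0
        · exact norm_le_tsum_norm hg n
    _ = _ := by ring

theorem Fop_add_mul {h' : ℕ → ℂ} {B' : ℝ} (hw : Summable fun k => ‖w k‖)
    (hg : Summable fun k => ‖hankel u w k‖) (hb : ∀ n, ‖h n‖ ≤ B) (hb' : ∀ n, ‖h' n‖ ≤ B')
    (c : ℂ) (n : ℕ) :
    Fop y u w (fun m => h m + c * h' m) n = Fop y u w h n + c * Fop y u w h' n := by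
  simp only [Fop, Gop, ← toeplitzConj_zero_eq]
  rw [funext fun m => toeplitzConj_add_mul hw hb hb' c m,
    funext fun m => toeplitzConj_add_mul hg hb hb' c m,
    mulCoeff_add_mul, mulCoeff_add_mul]
  ring

/-- The commutator of `G` with the backward shift. -/
theorem Gop_succ (y : ℝ) (u w h : ℕ → ℂ) (n : ℕ) :
    Gop y u w h (n + 1) = Gop y u w (fun m => h (m + 1)) n
      - y * toeplitzConj w h 0 * w (n + 1)
      + y ^ 2 * toeplitzConj (hankel u w) h 0 * hankel u w (n + 1) := by
  simp only [Gop, mulCoeff_eq_mul_zero_add, toeplitzConj_shift]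
  ring

/-- The commutator of `F` with the backward shift. -/
theorem Fop_succ (y : ℝ) (u w h : ℕ → ℂ) (n : ℕ) :
    Fop y u w h (n + 1) = Fop y u w (fun m => h (m + 1)) n
      + y ^ 2 * toeplitzConj (hankel u w) (fun m => h (m + 1)) 0 * hankel u w n
      - y * toeplitzConj w h 0 * w (n + 1) := by
  simp only [Fop, Gop_succ, ← toeplitzConj_zero_eq]
  ring

theorem Fop_zero (y : ℝ) (u w h : ℕ → ℂ) :
    Fop y u w h 0 = -y * w 0 * toeplitzConj w h 0 := by
  simp only [Fop, Gop, ← toeplitzConj_zero_eq, mulCoeff, zero_add, Finset.sum_range_one,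
    Nat.sub_self]
  ring

/-- The symmetry of `H_u` in terms of Toeplitz operators. -/
theorem toeplitzConj_hankel_zero {b : ℕ → ℂ} (hu : Summable fun k => ‖u k‖)
    (hc : Summable fun k => ‖b k‖) (hb : ∀ n, ‖h n‖ ≤ B) :
    toeplitzConj b (hankel u h) 0 = conj (toeplitzConj (hankel u b) h 0) := by
  rw [toeplitzConj_zero_eq, tsum_hankel_mul_conj_comm_s14 hu hc hb, toeplitzConj, Complex.conj_tsum]
  refine tsum_congr fun q => ?_
  simp

/-- The anticommutator `H_u F + F H_u` satisfies, up to a rank one term, the Hankel relation. -/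
theorem hankel_Fop_add_Fop_hankel_eq (hy : 0 ≤ y) (hu : Summable fun k => ‖u k‖)
    (hw : Summable fun k => ‖w k‖) (hres : IsResolventOne y u w) (hb : ∀ n, ‖h n‖ ≤ B) (n : ℕ) :
    hankel u (Fop y u w h) n + Fop y u w (hankel u h) n
      = conj (h 0) * (-2 * y * mulCoeff w (hankel u w) n)
        + (hankel u (Fop y u w fun m => h (m + 1)) (n + 1)
          + Fop y u w (hankel u fun m => h (m + 1)) (n + 1)) := by
  have hg := summable_norm_hankel hu hw
  have hgb := norm_le_tsum_norm hg
  have hwb := norm_le_tsum_norm hw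
  have hub := norm_le_tsum_norm hu
  have hkb : ∀ n, ‖h (n + 1)‖ ≤ B := fun n => hb (n + 1)
  set g := hankel u w with hgdef
  set k : ℕ → ℂ := fun m => h (m + 1) with hk
  have hFh := norm_Fop_le hy hw hg hb
  have hFk := norm_Fop_le hy hw hg hkb
  have hHg (m : ℕ) : y * hankel u g (m + 1) = -w (m + 1) := by
    have := hres.2 (m + 1)
    rw [if_neg (Nat.succ_ne_zero m)] at this
    linear_combination this
  have hHg0 : y * hankel u g 0 = 1 - w 0 := by
    have := hres.2 0
    rw [if_pos rfl] at this
    linear_combination this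
  have hswb : ∀ n, ‖w (n + 1)‖ ≤ ∑' k, ‖w k‖ := fun n => hwb (n + 1)
  -- the term `H_u F h`
  have hHF : hankel u (Fop y u w h) n
      = hankel u (Fop y u w k) (n + 1)
        - y * conj (toeplitzConj g k 0) * w (n + 1)
        - y * conj (toeplitzConj w h 0) * g n := by
    have h1 : (fun m => Fop y u w h (m + 1)) = fun m =>
        (fun j => Fop y u w k j + (y ^ 2 * toeplitzConj g k 0) * g j) m
          + (-y * toeplitzConj w h 0) * (fun j => w (j + 1)) m := by
      funext m
      rw [Fop_succ]
      ring
    have h2 : ∀ m, ‖Fop y u w k m + (y ^ 2 * toeplitzConj g k 0) * g m‖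
        ≤ _ + ‖(y ^ 2 * toeplitzConj g k 0 : ℂ)‖ * ∑' k, ‖g k‖ := fun m =>
      (norm_add_le _ _).trans (add_le_add (hFk m) (by
        rw [norm_mul]; exact mul_le_mul_of_nonneg_left (hgb m) (norm_nonneg _)))
    rw [hankel_eq_conj_mul_add hu hFh, h1, hankel_add_mul hu h2 hswb,
      hankel_add_mul hu hFk hgb, Fop_zero]
    have h3 := hankel_eq_conj_mul_add hu hwb n
    rw [← hgdef] at h3
    simp only [map_mul, map_neg, map_pow, Complex.conj_ofReal]
    linear_combination (y * conj (toeplitzConj w h 0)) * h3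
      + (y * conj (toeplitzConj g k 0)) * hHg n
  -- the term `F H_u h`
  have hHhk : (fun m => hankel u k (m + 1)) = fun m => hankel u h m + (-conj (h 0)) * u m := by
    funext m
    rw [hankel_eq_conj_mul_add hu hb m]
    ring
  have hHhb := norm_hankel_le hu hb
  have hFH : Fop y u w (hankel u k) (n + 1) = Fop y u w (hankel u h) n
      - conj (h 0) * Fop y u w u n
      + y ^ 2 * (toeplitzConj g (hankel u h) 0 - conj (h 0) * toeplitzConj g u 0) * g n
      - y * conj (toeplitzConj g k 0) * w (n + 1) := by
    rw [Fop_succ, hHhk, Fop_add_mul hw hg hHhb hub, toeplitzConj_add_mul hg hHhb hub,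
      toeplitzConj_hankel_zero hu hw hkb]
    ring
  have hsym : y * toeplitzConj g (hankel u h) 0 = conj (h 0) - conj (toeplitzConj w h 0) := by
    have h1 : ∀ q, y * hankel u g q = (if q = 0 then 1 else 0) - w q := fun q => by
      linear_combination hres.2 q
    rw [toeplitzConj_zero_eq, tsum_hankel_mul_conj_comm_s14 hu hg hb, ← tsum_mul_left,
      toeplitzConj_zero_eq, Complex.conj_tsum]
    have h2 : Summable fun q : ℕ => (if q = 0 then 1 else 0 : ℂ) * conj (h q) :=
      summable_of_ne_finset_zero (s := {0}) fun q hq => by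
        rw [if_neg (by simpa using hq), zero_mul]
    have h3 : Summable fun q => w q * conj (h q) := by
      simpa using summable_hankel hw hb 0
    have h4 : ∑' q : ℕ, (if q = 0 then 1 else 0 : ℂ) * conj (h q) = conj (h 0) := by
      rw [tsum_eq_single 0 fun q hq => by rw [if_neg hq, zero_mul], if_pos rfl, one_mul]
    have h5 : ∑' q, conj (h q * conj (w q)) = ∑' q, w q * conj (h q) :=
      tsum_congr fun q => by rw [map_mul, Complex.conj_conj, mul_comm]
    rw [h5, ← h4, ← h2.tsum_sub h3]
    refine tsum_congr fun q => ?_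
    rw [← mul_assoc, h1 q]
    ring
  have hFu : Fop y u w u n = -2 * y * mulCoeff w g n + y * w 0 * g n := by
    have h1 : (y : ℂ) * mulCoeff g (hankel u g) n = g n - mulCoeff w g n := by
      have h2 : ∀ q, y * hankel u g q = (if q = 0 then 1 else 0) - w q := fun q => by
        linear_combination hres.2 q
      rw [mulCoeff_comm_s14 w g]
      unfold mulCoeff
      rw [Finset.mul_sum, eq_sub_iff_add_eq, ← Finset.sum_add_distrib,
        Finset.sum_eq_single_of_mem n (by simp)]
      · have := h2 0
        rw [if_pos rfl] at this
        rw [Nat.sub_self]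
        linear_combination g n * this
      · intro q hq hqn
        have hq' := Finset.mem_range.mp hq
        have := h2 (n - q)
        rw [if_neg (by omega)] at this
        linear_combination g q * this
    simp only [Fop, Gop, ← toeplitzConj_zero_eq, ← hgdef, toeplitzConj_comm_hankel _ u]
    linear_combination (y : ℂ) * h1 - y * g n * hHg0
  have hgu : toeplitzConj g u 0 = hankel u g 0 := by rw [toeplitzConj_comm_hankel]
  rw [hHF, hFH, hFu, hgu]
  linear_combination (-y * g n) * hsym + (y * conj (h 0) * g n) * hHg0

/-- A family of functionals bounded for the sup norm that is invariant under the shift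
`D h n = D (S* h) (n + 1)` vanishes on sequences tending to zero. -/
theorem eq_zero_of_shift_invariant {D : (ℕ → ℂ) → ℕ → ℂ} {C : ℝ}
    (hD : ∀ (h : ℕ → ℂ) (B : ℝ), (∀ n, ‖h n‖ ≤ B) → ∀ n, ‖D h n‖ ≤ C * B)
    (hshift : ∀ (h : ℕ → ℂ) (B : ℝ), (∀ n, ‖h n‖ ≤ B) →
      ∀ n, D h n = D (fun m => h (m + 1)) (n + 1))
    (hb : ∀ n, ‖h n‖ ≤ B) (h0 : Filter.Tendsto h Filter.atTop (nhds 0)) (n : ℕ) :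
    D h n = 0 := by
  have hit (N : ℕ) : D h n = D (fun m => h (m + N)) (n + N) := by
    induction N with
    | zero => rfl
    | succ N ih =>
      rw [ih, hshift _ B fun m => hb _]
      simp only [add_assoc, add_comm 1 N]
  rw [← norm_le_zero_iff]
  have hlim : Filter.Tendsto (fun ε : ℝ => C * ε) (nhdsWithin 0 (Set.Ioi 0)) (nhds 0) := by
    have : Filter.Tendsto (fun ε : ℝ => C * ε) (nhds 0) (nhds (C * 0)) :=
      (continuous_const.mul continuous_id).tendsto 0
    rw [mul_zero] at this
    exact this.mono_left nhdsWithin_le_nhds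
  refine ge_of_tendsto hlim (Filter.eventually_of_mem self_mem_nhdsWithin fun ε hε => ?_)
  obtain ⟨N, hN⟩ := Metric.tendsto_atTop.mp h0 ε hε
  rw [hit N]
  exact hD _ ε (fun m => by simpa using (hN (m + N) (Nat.le_add_left _ _)).le) _

theorem I_mul_XJ (y : ℝ) (u w : ℕ → ℂ) :
    (fun m => Complex.I * XJ y u w m) = fun m => -2 * y * mulCoeff w (hankel u w) m := by
  funext m
  unfold XJ
  linear_combination (2 * y * mulCoeff w (hankel u w) m) * Complex.I_mul_I

theorem hankel_I_mul_XJ (hy : 0 ≤ y) (hu : Summable fun k => ‖u k‖)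
    (hw : Summable fun k => ‖w k‖) (hres : IsResolventOne y u w) (hb : ∀ n, ‖h n‖ ≤ B)
    (h0 : Filter.Tendsto h Filter.atTop (nhds 0)) (n : ℕ) :
    hankel (fun m => Complex.I * XJ y u w m) h n
      = hankel u (Fop y u w h) n + Fop y u w (hankel u h) n := by
  have hg := summable_norm_hankel hu hw
  rw [I_mul_XJ]
  have hX : Summable fun m => ‖-2 * (y : ℂ) * mulCoeff w (hankel u w) m‖ := by
    simp only [norm_mul (-2 * (y : ℂ))]
    exact (summable_norm_mulCoeff hw hg).mul_left _
  rw [← sub_eq_zero]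
  set K := y * (∑' k, ‖w k‖) ^ 2 + 2 * y ^ 2 * (∑' k, ‖hankel u w k‖) ^ 2 with hK
  refine eq_zero_of_shift_invariant
    (D := fun h n => hankel (fun m => -2 * y * mulCoeff w (hankel u w) m) h n
      - (hankel u (Fop y u w h) n + Fop y u w (hankel u h) n))
    (C := (∑' m, ‖-2 * (y : ℂ) * mulCoeff w (hankel u w) m‖)
      + 2 * (∑' k, ‖u k‖) * K) ?_ ?_ hb h0 n
  · intro h B hb n
    have h1 := norm_hankel_le hX hb n
    have h2 := norm_hankel_le hu (norm_Fop_le hy hw hg hb) n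
    have h3 := norm_Fop_le hy hw hg (norm_hankel_le hu hb) n
    refine (norm_sub_le _ _).trans ((add_le_add h1 ((norm_add_le _ _).trans
      (add_le_add h2 h3))).trans_eq ?_)
    rw [hK]
    ring
  · intro h B hb n
    rw [hankel_eq_conj_mul_add hX hb, hankel_Fop_add_Fop_hankel_eq hy hu hw hres hb n]
    ring

theorem shiftedHankel_I_mul_XJ (hy : 0 ≤ y) (hu : Summable fun k => ‖u k‖)
    (hw : Summable fun k => ‖w k‖) (hres : IsResolventOne y u w) (hb : ∀ n, ‖h n‖ ≤ B)
    (h0 : Filter.Tendsto h Filter.atTop (nhds 0)) (n : ℕ) :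
    shiftedHankel (fun m => Complex.I * XJ y u w m) h n
      = shiftedHankel u (Gop y u w h) n + Gop y u w (shiftedHankel u h) n := by
  have hg := summable_norm_hankel hu hw
  have hG : Gop y u w h = fun m => Fop y u w h m
      + (y ^ 2 * toeplitzConj (hankel u w) h 0) * hankel u w m := by
    funext m
    simp only [Fop, ← toeplitzConj_zero_eq]
    ring
  have hHG : hankel u (Gop y u w h) (n + 1) = hankel u (Fop y u w h) (n + 1)
      + y ^ 2 * conj (toeplitzConj (hankel u w) h 0) * hankel u (hankel u w) (n + 1) := by
    rw [hG, hankel_add_mul hu (norm_Fop_le hy hw hg hb) (norm_le_tsum_norm hg)]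
    simp
  have hHg : y * hankel u (hankel u w) (n + 1) = -w (n + 1) := by
    have := hres.2 (n + 1)
    rw [if_neg (Nat.succ_ne_zero n)] at this
    linear_combination this
  have hF : Fop y u w (hankel u h) (n + 1) = Gop y u w (hankel u h) (n + 1)
      - y ^ 2 * toeplitzConj (hankel u w) (hankel u h) 0 * hankel u w (n + 1) := by
    simp only [Fop, ← toeplitzConj_zero_eq]
  have hs : shiftedHankel u h = fun m => hankel u h (m + 1) := rfl
  have hsucc := Gop_succ y u w (hankel u h) n
  rw [toeplitzConj_hankel_zero hu hw hb] at hsucc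
  rw [hs, shiftedHankel, hankel_I_mul_XJ hy hu hw hres hb h0, shiftedHankel, hHG, hF, hsucc]
  linear_combination (-y * conj (toeplitzConj (hankel u w) h 0)) * hHg

end operators

theorem Memℓp.exists_norm_le_and_tendsto {h : ℕ → ℂ} (hh : Memℓp h 2) :
    (∃ B : ℝ, ∀ n, ‖h n‖ ≤ B) ∧ Filter.Tendsto h Filter.atTop (nhds 0) := by
  have h1 : Summable fun n => ‖h n‖ ^ 2 := by
    simpa using hh.summable (by norm_num)
  have h2 : Filter.Tendsto h Filter.atTop (nhds 0) := by
    rw [tendsto_zero_iff_norm_tendsto_zero]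
    simpa using h1.tendsto_atTop_zero.sqrt
  refine ⟨?_, h2⟩
  obtain ⟨B, hB⟩ := h2.norm.bddAbove_range
  exact ⟨B, fun n => hB ⟨n, rfl⟩⟩

/-- **Theorem 5.2, first part**: `H_{iX_{J^y}(u)} = H_u F_u^y + F_u^y H_u` and
`K_{iX_{J^y}(u)} = K_u G_u^y + G_u^y K_u`, where `w` denotes `w^y = (I + yH_u²)⁻¹(1)`. -/
theorem statement14 (s y : ℝ) (hs : 1 / 2 < s) (hy : 0 < y) (u w : ℕ → ℂ)
    (hu : InHs s u) (hu2 : Memℓp u 2) (hw : IsResolventOne y u w)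
    (h : ℕ → ℂ) (hh : Memℓp h 2) (n : ℕ) :
    hankel (fun m => Complex.I * XJ y u w m) h n
      = hankel u (Fop y u w h) n + Fop y u w (hankel u h) n ∧
    shiftedHankel (fun m => Complex.I * XJ y u w m) h n
      = shiftedHankel u (Gop y u w h) n + Gop y u w (shiftedHankel u h) n := by
  have hu1 := hu.summable_norm hs
  obtain ⟨⟨_, hwB⟩, -⟩ := hw.1.exists_norm_le_and_tendsto
  obtain ⟨⟨_, hb⟩, h0⟩ := hh.exists_norm_le_and_tendsto
  have hw1 := hw.summable_norm hy.le hu1 hwB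
  exact ⟨hankel_I_mul_XJ hy.le hu1 hw1 hw hb h0 n,
    shiftedHankel_I_mul_XJ hy.le hu1 hw1 hw hb h0 n⟩

end
end
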